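/- Let Ω ⊂ ℝ² be a bounded open set and ψ : ∂Ω → ℝ continuous. Suppose u solves the variational problem (P) and u is continuously differentiable on Ω. Then the critical set {z ∈ Ω : ∇u(z) = 0} has no isolated points; that is, there is no z₀ ∈ Ω with ∇u(z₀) = 0 and no r > 0 such that ∇u(z) ≠ 0 for all z with 0 < ‖z − z₀‖ < r. -/

import Mathlib

open Set MeasureTheory Metric Filter
open scoped RealInnerProductSpace Topology Classical

noncomputable section

abbrev E2 := EuclideanSpace ℝ (Fin 2)

/-- A function is Lipschitz on a set (with some constant). -/
def LipOn (w : E2 → ℝ) (s : Set E2) : Prop := ∃ L : NNReal, LipschitzOnWith L w s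

/-- The functional `J(w) = ∫_Ω f(‖∇w‖)`, with `∇w` the a.e.-defined (Rademacher) gradient,
extended by the junk value `0` where `w` is not differentiable. -/
def J (f : ℝ → ℝ) (Ω : Set E2) (w : E2 → ℝ) : ℝ := ∫ x in Ω, f ‖gradient w x‖

/-- The (one-sided at `0`) derivative of `f` on `[0,∞)`. -/
def dtop (f : ℝ → ℝ) : ℝ → ℝ := derivWithin f (Set.Ici 0)

/-- Standing assumptions on the Lagrangian `f` : strictly convex on `[0,∞)`, `C¹` on `[0,∞)`,
`C²` on `(0,∞)` with `f''` locally Hölder continuous of some exponent `λ ∈ (0,1)`,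
and `f'(0) > 0`. -/
def StdF (f : ℝ → ℝ) : Prop :=
  StrictConvexOn ℝ (Set.Ici 0) f ∧ ContDiffOn ℝ 1 f (Set.Ici 0) ∧
  ContDiffOn ℝ 2 f (Set.Ioi 0) ∧
  (∃ lam : NNReal, 0 < lam ∧ lam < 1 ∧ ∀ K : Set ℝ, IsCompact K → K ⊆ Set.Ioi 0 →
    ∃ C : NNReal, HolderOnWith C lam (deriv (dtop f)) K) ∧
  0 < dtop f 0

/-- `u` solves the variational problem (P): `u` is Lipschitz on the closure of `Ω`,
`u = ψ` on `∂Ω`, and `u` minimizes `J` among such functions. -/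
def SolvesP (f : ℝ → ℝ) (Ω : Set E2) (ψ : E2 → ℝ) (u : E2 → ℝ) : Prop :=
  LipOn u (closure Ω) ∧ EqOn u ψ (frontier Ω) ∧
  ∀ w : E2 → ℝ, LipOn w (closure Ω) → EqOn w ψ (frontier Ω) → J f Ω u ≤ J f Ω w

/-- `u` has an isolated critical point in `Ω`. -/
def HasIsolatedCritPt (Ω : Set E2) (u : E2 → ℝ) : Prop :=
  ∃ z₀ ∈ Ω, ∃ r > (0:ℝ), gradient u z₀ = 0 ∧
    ∀ z ∈ Ω, z ≠ z₀ → dist z z₀ < r → gradient u z ≠ 0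

/-- Symmetric difference quotients converge to the directional derivative. -/
theorem tendsto_symm_diff_quotient {A : ℂ → ℝ} {z : ℂ} (hA : DifferentiableAt ℝ A z) (a : ℂ) :
    Tendsto (fun t : ℝ => (2 * t)⁻¹ * (A (z + t • a) - A (z - t • a))) (𝓝[>] 0)
      (𝓝 (fderiv ℝ A z a)) := by
  have h1 : HasDerivAt (fun t : ℝ => A (z + t • a)) (fderiv ℝ A z a) 0 := by
    have hl : HasDerivAt (fun t : ℝ => z + t • a) a 0 := by
      simpa using ((hasDerivAt_id (0 : ℝ)).smul_const a).const_add z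
    have hA' : HasFDerivAt A (fderiv ℝ A z) (z + (0 : ℝ) • a) := by simpa using hA.hasFDerivAt
    exact hA'.comp_hasDerivAt 0 hl
  have h2 : HasDerivAt (fun t : ℝ => A (z - t • a)) (-(fderiv ℝ A z a)) 0 := by
    have hl : HasDerivAt (fun t : ℝ => z - t • a) (-a) 0 := by
      simpa using ((hasDerivAt_id (0 : ℝ)).smul_const a).const_sub z
    have hA' : HasFDerivAt A (fderiv ℝ A z) (z - (0 : ℝ) • a) := by simpa using hA.hasFDerivAt
    have h := hA'.comp_hasDerivAt 0 hl
    rw [map_neg] at h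
    exact h
  have h3 := (h1.sub h2).tendsto_slope_zero_right
  have h4 := h3.const_mul (2⁻¹ : ℝ)
  refine (h4.congr fun t => ?_).trans (by ring_nf; rfl)
  simp
  ring

/-- The integral of a product of symmetric differences is symmetric in the two directions. -/
theorem integral_symm_diff_comm {A B : ℂ → ℝ} (hA : Continuous A) (hB : Continuous B)
    (hAs : HasCompactSupport A) (a b : ℂ) :
    ∫ z, (A (z + a) - A (z - a)) * (B (z + b) - B (z - b)) =
      ∫ z, (A (z + b) - A (z - b)) * (B (z + a) - B (z - a)) := by
  have hint : ∀ p q : ℂ, Integrable (fun z => A (z + p) * B (z + q)) := fun p q => by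
    refine Continuous.integrable_of_hasCompactSupport (by fun_prop) ?_
    exact (hAs.comp_homeomorph (Homeomorph.addRight p)).mul_right
  have hexp : ∀ p q : ℂ, ∫ z, (A (z + p) - A (z - p)) * (B (z + q) - B (z - q)) =
      (∫ z, A (z + p) * B (z + q)) - (∫ z, A (z + p) * B (z + -q))
        - (∫ z, A (z + -p) * B (z + q)) + ∫ z, A (z + -p) * B (z + -q) := fun p q => by
    have e : ∀ z, (A (z + p) - A (z - p)) * (B (z + q) - B (z - q)) =
        (A (z + p) * B (z + q) - A (z + p) * B (z + -q)) -
          (A (z + -p) * B (z + q) - A (z + -p) * B (z + -q)) := fun z => by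
      simp only [sub_eq_add_neg]
      ring
    simp only [e]
    refine (integral_sub ((hint p q).sub (hint p (-q)))
      ((hint (-p) q).sub (hint (-p) (-q)))).trans ?_
    simp only [Pi.sub_apply]
    rw [integral_sub (hint _ _) (hint _ _), integral_sub (hint _ _) (hint _ _)]
    ring
  have htr : ∀ p q r : ℂ, ∫ z, A (z + p) * B (z + q) = ∫ z, A (z + (p + r)) * B (z + (q + r)) :=
    fun p q r => by
      rw [← integral_add_right_eq_self (fun z => A (z + p) * B (z + q)) r]
      congr 1
      ext z
      congr 2 <;> ring
  have h1 := htr a b (-a - b)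
  have h2 := htr (-a) (-b) (a + b)
  have h3 := htr a (-b) (b - a)
  have h4 := htr (-a) b (a - b)
  rw [show a + (-a - b) = -b by ring, show b + (-a - b) = -a by ring] at h1
  rw [show -a + (a + b) = b by ring, show -b + (a + b) = a by ring] at h2
  rw [show a + (b - a) = b by ring, show -b + (b - a) = -a by ring] at h3
  rw [show -a + (a - b) = -b by ring, show b + (a - b) = a by ring] at h4
  rw [hexp, hexp, h1, h2, h3, h4]
  ring

/-- The Jacobian of a compactly supported Lipschitz map of the plane is integrable, with zero
integral. -/
theorem integrable_jacobian_and_integral_eq_zero {A B : ℂ → ℝ} {CA CB : NNReal}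
    (hA : LipschitzWith CA A) (hB : LipschitzWith CB B) (hAs : HasCompactSupport A) :
    Integrable (fun z => fderiv ℝ A z 1 * fderiv ℝ B z Complex.I
      - fderiv ℝ A z Complex.I * fderiv ℝ B z 1) ∧
    ∫ z, (fderiv ℝ A z 1 * fderiv ℝ B z Complex.I
      - fderiv ℝ A z Complex.I * fderiv ℝ B z 1) = 0 := by
  have key : ∀ a b : ℂ, ‖a‖ = 1 → ‖b‖ = 1 →
      Integrable (fun z => fderiv ℝ A z a * fderiv ℝ B z b) ∧
      Tendsto (fun t : ℝ => ∫ z, ((2 * t)⁻¹ * (A (z + t • a) - A (z - t • a))) *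
        ((2 * t)⁻¹ * (B (z + t • b) - B (z - t • b)))) (𝓝[>] 0)
        (𝓝 (∫ z, fderiv ℝ A z a * fderiv ℝ B z b)) := by
    intro a b ha hb
    have hquot : ∀ {D : ℂ → ℝ} {C : NNReal}, LipschitzWith C D → ∀ (e : ℂ), ‖e‖ = 1 → ∀ t > (0:ℝ),
        ∀ z, |(2 * t)⁻¹ * (D (z + t • e) - D (z - t • e))| ≤ C := by
      intro D C hD e he t ht z
      have h := hD.dist_le_mul (z + t • e) (z - t • e)
      rw [Real.dist_eq, dist_eq_norm] at h
      have h2 : ‖z + t • e - (z - t • e)‖ = 2 * t := by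
        have : z + t • e - (z - t • e) = (2 * t) • e := by rw [mul_smul, two_smul]; ring
        rw [this, norm_smul, he, Real.norm_of_nonneg (by positivity), mul_one]
      rw [h2] at h
      rw [abs_mul, abs_of_pos (by positivity : (0:ℝ) < (2 * t)⁻¹), inv_mul_le_iff₀ (by positivity)]
      linarith
    set K : Set ℂ := cthickening 1 (tsupport A) with hK
    have hKc : IsCompact K := hAs.isCompact.cthickening
    set bd : ℂ → ℝ := K.indicator fun _ => (CA * CB : ℝ)
    have hbd : Integrable bd :=
      (integrable_indicator_iff hKc.measurableSet).2 (integrableOn_const hKc.measure_lt_top.ne)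
    have hAoff : ∀ t ∈ Ioo (0:ℝ) 1, ∀ z ∉ K, A (z + t • a) - A (z - t • a) = 0 := by
      intro t ht z hz
      have : ∀ y : ℂ, dist z y ≤ 1 → A y = 0 := fun y hy => by
        by_contra hne
        exact hz (mem_cthickening_of_dist_le z y 1 _ (subset_tsupport A hne) hy)
      rw [this, this, sub_zero] <;>
        simp [dist_eq_norm, ha, abs_of_pos ht.1, ht.2.le]
    have hlim : Tendsto (fun t : ℝ => ∫ z, ((2 * t)⁻¹ * (A (z + t • a) - A (z - t • a))) *
        ((2 * t)⁻¹ * (B (z + t • b) - B (z - t • b)))) (𝓝[>] 0)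
        (𝓝 (∫ z, fderiv ℝ A z a * fderiv ℝ B z b)) := by
      refine tendsto_integral_filter_of_dominated_convergence bd ?_ ?_ hbd ?_
      · refine Eventually.of_forall fun t => Continuous.aestronglyMeasurable ?_
        have := hA.continuous
        have := hB.continuous
        fun_prop
      · filter_upwards [Ioo_mem_nhdsGT (zero_lt_one (α := ℝ))] with t ht
        refine Eventually.of_forall fun z => ?_
        by_cases hz : z ∈ K
        · rw [show bd z = CA * CB from indicator_of_mem hz _, norm_mul]
          exact mul_le_mul (hquot hA a ha t ht.1 z) (hquot hB b hb t ht.1 z) (norm_nonneg _) CA.2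
        · rw [show bd z = 0 from indicator_of_notMem hz _, hAoff t ht z hz]
          simp
      · filter_upwards [hA.ae_differentiableAt, hB.ae_differentiableAt] with z h1 h2
        exact (tendsto_symm_diff_quotient h1 a).mul (tendsto_symm_diff_quotient h2 b)
    refine ⟨?_, hlim⟩
    refine hbd.mono' ?_ (Eventually.of_forall fun z => ?_)
    · exact ((measurable_fderiv_apply_const ℝ A a).mul
        (measurable_fderiv_apply_const ℝ B b)).aestronglyMeasurable
    · have hn : ∀ {D : ℂ → ℝ} {C : NNReal}, LipschitzWith C D → ∀ (e : ℂ), ‖e‖ = 1 →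
          ‖fderiv ℝ D z e‖ ≤ C := fun {D C} hD e he => by
        have := (fderiv ℝ D z).le_of_opNorm_le (norm_fderiv_le_of_lipschitz ℝ hD) e
        simpa [he] using this
      by_cases hz : z ∈ K
      · rw [show bd z = CA * CB from indicator_of_mem hz _, norm_mul]
        exact mul_le_mul (hn hA a ha) (hn hB b hb) (norm_nonneg _) CA.2
      · rw [show bd z = 0 from indicator_of_notMem hz _]
        have : fderiv ℝ A z = 0 := by
          refine image_eq_zero_of_notMem_tsupport fun h => hz ?_
          exact self_subset_cthickening _ (tsupport_fderiv_subset ℝ h)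
        simp [this]
  obtain ⟨i1, l1⟩ := key 1 Complex.I (by simp) (by simp)
  obtain ⟨i2, l2⟩ := key Complex.I 1 (by simp) (by simp)
  refine ⟨i1.sub i2, ?_⟩
  rw [integral_sub i1 i2, sub_eq_zero]
  refine tendsto_nhds_unique l1 (l2.congr fun t => ?_)
  have h := integral_symm_diff_comm hA.continuous hB.continuous hAs (t • (1:ℂ)) (t • Complex.I)
  have h' : ∀ a b : ℂ, ∫ z, ((2 * t)⁻¹ * (A (z + a) - A (z - a))) *
      ((2 * t)⁻¹ * (B (z + b) - B (z - b))) =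
      ((2 * t)⁻¹) ^ 2 * ∫ z, (A (z + a) - A (z - a)) * (B (z + b) - B (z - b)) := fun a b => by
    rw [← integral_const_mul]
    congr 1
    ext z
    ring
  rw [h', h', h]

theorem innerSL_apply_one (p : ℂ) : innerSL ℝ p (1 : ℂ) = p.re := by
  simp [Complex.inner]

theorem innerSL_apply_I (p : ℂ) : innerSL ℝ p Complex.I = p.im := by
  simp [Complex.inner]

theorem contDiffOn_one_of_hasFDerivAt_innerSL {U : Set ℂ} (hU : IsOpen U) {h : ℂ → ℝ} {p : ℂ → ℂ}
    (hd : ∀ w ∈ U, HasFDerivAt h (innerSL ℝ (p w)) w) (hp : ContinuousOn p U) :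
    ContDiffOn ℝ 1 h U := by
  rw [← zero_add 1, contDiffOn_succ_iff_fderiv_of_isOpen hU]
  refine ⟨fun w hw => (hd w hw).differentiableAt.differentiableWithinAt, by simp, ?_⟩
  rw [contDiffOn_zero]
  exact ((innerSL ℝ (E := ℂ)).continuous.comp_continuousOn hp).congr fun w hw => (hd w hw).fderiv

theorem contDiff_indicator_of_isCompact {U K : Set ℂ} (hU : IsOpen U) (hK : IsCompact K)
    (hKU : K ⊆ U) {h : ℂ → ℝ} (hh : ContDiffOn ℝ 1 h U) (h0 : ∀ z ∈ U, z ∉ K → h z = 0) :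
    ContDiff ℝ 1 (U.indicator h) ∧ HasCompactSupport (U.indicator h) := by
  have hz : ∀ z ∉ K, U.indicator h z = 0 := fun z hz => by
    by_cases hzU : z ∈ U
    · rw [indicator_of_mem hzU, h0 z hzU hz]
    · exact indicator_of_notMem hzU _
  refine ⟨contDiff_iff_contDiffAt.2 fun z => ?_, HasCompactSupport.intro hK hz⟩
  by_cases hzU : z ∈ U
  · refine (hh.contDiffAt (hU.mem_nhds hzU)).congr_of_eventuallyEq ?_
    filter_upwards [hU.mem_nhds hzU] with y hy using indicator_of_mem hy _
  · refine contDiffAt_const (c := (0 : ℝ)) |>.congr_of_eventuallyEq ?_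
    filter_upwards [hK.isClosed.isOpen_compl.mem_nhds fun hzK => hzU (hKU hzK)] with y hy
      using hz y hy

theorem expNegInvGlue_deriv_pos {x : ℝ} (hx : 0 < x) : 0 < deriv expNegInvGlue x := by
  have h := expNegInvGlue.hasDerivAt_polynomial_eval_inv_mul 1 x
  simp only [Polynomial.eval_one, one_mul, Polynomial.derivative_one, sub_zero, mul_one,
    Polynomial.eval_pow, Polynomial.eval_X] at h
  rw [HasDerivAt.deriv h]
  have := expNegInvGlue.pos_of_pos hx
  positivity

theorem deriv_nonneg_expNegInvGlue (x : ℝ) : 0 ≤ deriv expNegInvGlue x :=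
  expNegInvGlue.monotone.deriv_nonneg

section MaxPrinciple

variable {t s : ℂ → ℝ} {p r : ℂ → ℂ} {c : ℂ} {ρ : ℝ} {S : Set ℂ}

/-- Where the first component exceeds its boundary values and the second one avoids the
exceptional values, a map with nonnegative Jacobian has zero Jacobian. -/
theorem jacobian_eq_zero_of_lt (hS : S.Finite)
    (ht : ContinuousOn t (closedBall c ρ)) (hs : ContinuousOn s (closedBall c ρ))
    (htd : ∀ w ∈ ball c ρ \ S, HasFDerivAt t (innerSL ℝ (p w)) w)
    (hsd : ∀ w ∈ ball c ρ \ S, HasFDerivAt s (innerSL ℝ (r w)) w)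
    (hp : ContinuousOn p (ball c ρ \ S)) (hr : ContinuousOn r (ball c ρ \ S))
    (hdet : ∀ w ∈ ball c ρ \ S, 0 ≤ (p w).re * (r w).im - (p w).im * (r w).re)
    {m : ℝ} (hm : ∀ w ∈ sphere c ρ, t w ≤ m) {w : ℂ} (hw : w ∈ ball c ρ \ S) (hmw : m < t w)
    (hws : s w ∉ s '' S) : (p w).re * (r w).im - (p w).im * (r w).re = 0 := by
  set U := ball c ρ \ S with hUdef
  have hU : IsOpen U := isOpen_ball.sdiff hS.isClosed
  obtain ⟨c', hmc, hct⟩ := exists_between hmw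
  obtain ⟨δ, hδ, hball⟩ := nhds_basis_closedBall.mem_iff.1
    ((hS.image s).isClosed.isOpen_compl.mem_nhds hws)
  let ψ : ContDiffBump (s w) := ⟨δ / 2, δ, by positivity, by linarith⟩
  set K : Set ℂ := {z ∈ closedBall c ρ | c' ≤ t z ∧ s z ∈ closedBall (s w) δ} with hKdef
  have hK : IsCompact K := by
    have h1 := ht.preimage_isClosed_of_isClosed isClosed_closedBall (isClosed_Ici (a := c'))
    have h2 := hs.preimage_isClosed_of_isClosed isClosed_closedBall
      (isClosed_closedBall (x := s w) (ε := δ))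
    refine ((isCompact_closedBall c ρ).inter_right (h1.inter h2)).of_isClosed_subset ?_ ?_
    · convert h1.inter h2 using 1
      ext z
      simp only [hKdef, mem_ofPred_eq, mem_inter_iff, mem_preimage, mem_Ici]
      tauto
    · intro z hz
      exact ⟨hz.1, ⟨hz.1, hz.2.1⟩, hz.1, hz.2.2⟩
  have hKU : K ⊆ U := fun z hz => by
    refine ⟨?_, fun hzS => hball hz.2.2 ⟨z, hzS, rfl⟩⟩
    rcases (mem_closedBall.1 hz.1).lt_or_eq with h | h
    · exact h
    · exact absurd (hm z h) (by linarith [hz.2.1])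
  have htC := contDiffOn_one_of_hasFDerivAt_innerSL hU htd hp
  have hsC := contDiffOn_one_of_hasFDerivAt_innerSL hU hsd hr
  have hgC : ContDiff ℝ 1 expNegInvGlue := expNegInvGlue.contDiff (n := 1)
  have hψC : ContDiff ℝ 1 ψ := ψ.contDiff
  obtain ⟨hA, hAs⟩ := contDiff_indicator_of_isCompact hU hK hKU
    (h := fun z => expNegInvGlue (t z - c') * ψ (s z))
    ((hgC.comp_contDiffOn (htC.sub contDiffOn_const)).mul (hψC.comp_contDiffOn hsC))
    (fun z hz hzK => by
      by_cases h1 : c' ≤ t z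
      · have : δ ≤ dist (s z) (s w) := by
          by_contra h2
          exact hzK ⟨ball_subset_closedBall hz.1, h1, (not_le.1 h2).le⟩
        rw [ψ.zero_of_le_dist this, mul_zero]
      · rw [expNegInvGlue.zero_of_nonpos (by linarith), zero_mul])
  set A := U.indicator fun z => expNegInvGlue (t z - c') * ψ (s z) with hAdef
  obtain ⟨χ, hχ0, hχ1, -⟩ := exists_contMDiffMap_zero_one_nhds_of_isClosed (n := 1)
    (modelWithCornersSelf ℝ ℂ) hU.isClosed_compl hK.isClosed
    (disjoint_compl_left_iff_subset.2 hKU)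
  have hχC : ContDiff ℝ 1 χ := χ.contMDiff.contDiff
  have hχU : tsupport χ ⊆ U := fun z hz => by
    by_contra hzU
    rw [← mem_compl_iff] at hzU
    exact (notMem_tsupport_iff_eventuallyEq.2 (hχ0.filter_mono (nhds_le_nhdsSet hzU))) hz
  have hχK : IsCompact (tsupport χ) := (isCompact_closedBall c ρ).of_isClosed_subset
    (isClosed_tsupport _) fun z hz => ball_subset_closedBall (hχU hz).1
  obtain ⟨hB, hBs⟩ := contDiff_indicator_of_isCompact hU hχK hχU
    (h := fun z => χ z * s z) (hχC.contDiffOn.mul hsC)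
    (fun z _ hz => by rw [image_eq_zero_of_notMem_tsupport hz, zero_mul])
  set B := U.indicator fun z => χ z * s z with hBdef
  obtain ⟨CA, hAL⟩ := hA.lipschitzWith_of_hasCompactSupport hAs one_ne_zero
  obtain ⟨CB, hBL⟩ := hB.lipschitzWith_of_hasCompactSupport hBs one_ne_zero
  have hint := (integrable_jacobian_and_integral_eq_zero hAL hBL hAs).2
  have hAoff : ∀ z ∉ K, fderiv ℝ A z = 0 := fun z hz => by
    have : A =ᶠ[𝓝 z] fun _ => 0 := by
      filter_upwards [hK.isClosed.isOpen_compl.mem_nhds hz] with y hy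
      by_cases hyU : y ∈ U
      · rw [hAdef, indicator_of_mem hyU]
        by_cases h1 : c' ≤ t y
        · have : δ ≤ dist (s y) (s w) := by
            by_contra h2
            exact hy ⟨ball_subset_closedBall hyU.1, h1, (not_le.1 h2).le⟩
          rw [ψ.zero_of_le_dist this, mul_zero]
        · rw [expNegInvGlue.zero_of_nonpos (by linarith), zero_mul]
      · exact indicator_of_notMem hyU _
    rw [this.fderiv_eq, fderiv_const_apply]
  have hform : ∀ z ∈ K, fderiv ℝ A z 1 * fderiv ℝ B z Complex.I
      - fderiv ℝ A z Complex.I * fderiv ℝ B z 1 = deriv expNegInvGlue (t z - c') * ψ (s z) *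
        ((p z).re * (r z).im - (p z).im * (r z).re) := fun z hz => by
    have hzU := hKU hz
    have hBe : B =ᶠ[𝓝 z] s := by
      filter_upwards [hU.mem_nhds hzU, hχ1.filter_mono (nhds_le_nhdsSet hz)] with y hy hy1
      rw [hBdef, indicator_of_mem hy, hy1, one_mul]
    have hAe : A =ᶠ[𝓝 z] fun z => expNegInvGlue (t z - c') * ψ (s z) := by
      filter_upwards [hU.mem_nhds hzU] with y hy using indicator_of_mem hy _
    have h1 : HasFDerivAt (fun z => expNegInvGlue (t z - c'))
        (deriv expNegInvGlue (t z - c') • innerSL ℝ (p z)) z :=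
      ((hgC.differentiable one_ne_zero _).hasDerivAt).comp_hasFDerivAt z
        ((htd z hzU).sub_const c')
    have h2 : HasFDerivAt (fun z => ψ (s z)) (deriv ψ (s z) • innerSL ℝ (r z)) z :=
      ((hψC.differentiable one_ne_zero _).hasDerivAt).comp_hasFDerivAt z (hsd z hzU)
    have h3 : HasFDerivAt (fun z => expNegInvGlue (t z - c') * ψ (s z)) _ z := h1.mul h2
    rw [hAe.fderiv_eq, hBe.fderiv_eq, h3.fderiv, (hsd z hzU).fderiv]
    simp only [add_apply, smul_apply, innerSL_apply_one,
      innerSL_apply_I, smul_eq_mul]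
    ring
  have hnn : ∀ z, 0 ≤ fderiv ℝ A z 1 * fderiv ℝ B z Complex.I
      - fderiv ℝ A z Complex.I * fderiv ℝ B z 1 := fun z => by
    by_cases hz : z ∈ K
    · rw [hform z hz]
      exact mul_nonneg (mul_nonneg (deriv_nonneg_expNegInvGlue _) ψ.nonneg) (hdet z (hKU hz))
    · simp [hAoff z hz]
  have hcont : Continuous fun z => fderiv ℝ A z 1 * fderiv ℝ B z Complex.I
      - fderiv ℝ A z Complex.I * fderiv ℝ B z 1 := by
    have h1 := hA.continuous_fderiv one_ne_zero
    have h2 := hB.continuous_fderiv one_ne_zero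
    fun_prop
  have hsupp : HasCompactSupport fun z => fderiv ℝ A z 1 * fderiv ℝ B z Complex.I
      - fderiv ℝ A z Complex.I * fderiv ℝ B z 1 :=
    HasCompactSupport.intro hK fun z hz => by simp [hAoff z hz]
  have hwK : w ∈ K := ⟨ball_subset_closedBall hw.1, hct.le, mem_closedBall_self hδ.le⟩
  by_contra hne
  refine (hcont.integral_pos_of_hasCompactSupport_nonneg_nonzero (μ := volume) (x := w) hsupp
    hnn ?_).ne' hint
  rw [hform w hwK]
  refine mul_ne_zero (mul_ne_zero (expNegInvGlue_deriv_pos (by linarith)).ne' ?_) hne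
  exact (ψ.pos_of_mem_ball (mem_ball_self hδ)).ne'

/-- A maximum principle for the first component of a map with nonnegative Jacobian, continuous on
a closed disc and continuously differentiable off a finite set. -/
theorem le_of_le_sphere_of_jacobian_nonneg (hS : S.Finite)
    (ht : ContinuousOn t (closedBall c ρ)) (hs : ContinuousOn s (closedBall c ρ))
    (htd : ∀ w ∈ ball c ρ \ S, HasFDerivAt t (innerSL ℝ (p w)) w)
    (hsd : ∀ w ∈ ball c ρ \ S, HasFDerivAt s (innerSL ℝ (r w)) w)
    (hp : ContinuousOn p (ball c ρ \ S)) (hr : ContinuousOn r (ball c ρ \ S))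
    (hdet : ∀ w ∈ ball c ρ \ S, 0 ≤ (p w).re * (r w).im - (p w).im * (r w).re)
    (hdet0 : ∀ w ∈ ball c ρ \ S, (p w).re * (r w).im - (p w).im * (r w).re = 0 → p w = 0)
    {m : ℝ} (hm : ∀ w ∈ sphere c ρ, t w ≤ m) : ∀ w ∈ closedBall c ρ, t w ≤ m := by
  have hU : IsOpen (ball c ρ \ S) := isOpen_ball.sdiff hS.isClosed
  have hp0 : ∀ w ∈ ball c ρ \ S, m < t w → p w = 0 := fun w hw hmw => by
    refine hdet0 w hw ?_
    by_contra hne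
    have hcont : ContinuousAt (fun z => (p z).re * (r z).im - (p z).im * (r z).re) w := by
      have h1 := hp.continuousAt (hU.mem_nhds hw)
      have h2 := hr.continuousAt (hU.mem_nhds hw)
      exact ((Complex.continuous_re.continuousAt.comp h1).mul
        (Complex.continuous_im.continuousAt.comp h2)).sub
        ((Complex.continuous_im.continuousAt.comp h1).mul
        (Complex.continuous_re.continuousAt.comp h2))
    have hsc : ContinuousAt s w := (hsd w hw).continuousAt
    have hmem : ∀ᶠ z in 𝓝 w, s z ∈ s '' S := by
      filter_upwards [hcont.eventually_ne hne, hU.mem_nhds hw,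
        (htd w hw).continuousAt.eventually_const_lt hmw] with z h1 h2 h3
      by_contra h4
      exact h1 (jacobian_eq_zero_of_lt hS ht hs htd hsd hp hr hdet hm h2 h3 h4)
    have hconst : s =ᶠ[𝓝 w] fun _ => s w := by
      have hfin : (s '' S \ {s w}).Finite := (hS.image s).subset sdiff_subset
      have h5 := hsc.eventually (hfin.isClosed.isOpen_compl.mem_nhds fun h => h.2 rfl)
      filter_upwards [hmem, h5] with z h1 h2
      by_contra h3
      exact h2 ⟨h1, h3⟩
    have hr0 : r w = 0 := by
      have h1 := (hsd w hw).unique (hconst.hasFDerivAt_iff.2 (hasFDerivAt_const (s w) w))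
      apply Complex.ext
      · rw [← innerSL_apply_one, h1]; simp
      · rw [← innerSL_apply_I, h1]; simp
    exact hne (by simp [hr0])
  intro w hw
  by_contra! hmw
  obtain ⟨m', hm1, hm2⟩ := exists_between hmw
  have hwρ : dist w c < ρ := lt_of_le_of_ne hw fun h => (hm w h).not_gt hmw
  have hρ : 0 < ρ := dist_nonneg.trans_lt hwρ
  -- move along a ray from `w` to the sphere
  obtain ⟨y, hy, e, he, τ, hτ, hyw, hin⟩ : ∃ y ∈ sphere c ρ, ∃ e : ℂ, e ≠ 0 ∧ ∃ τ : ℝ, 0 < τ ∧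
      y = w + τ • e ∧ ∀ x ∈ Ico (0 : ℝ) τ, w + x • e ∈ ball c ρ := by
    have hnt : (sphere c ρ).Nonempty := NormedSpace.sphere_nonempty.2 hρ.le
    obtain ⟨y, hy⟩ := hnt
    refine ⟨y, hy, y - w, ?_, 1, one_pos, by simp, fun x hx => ?_⟩
    · rw [sub_ne_zero]
      rintro rfl
      exact hwρ.ne hy
    · have hc1 : dist (w + x • (y - w)) c ≤ (1 - x) * dist w c + x * dist y c := by
        rw [dist_eq_norm, dist_eq_norm, dist_eq_norm]
        have : w + x • (y - w) - c = (1 - x) • (w - c) + x • (y - c) := by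
          simp only [smul_sub, sub_smul, one_smul]; ring
        rw [this]
        refine (norm_add_le _ _).trans ?_
        rw [norm_smul, norm_smul, Real.norm_of_nonneg hx.1,
          Real.norm_of_nonneg (by linarith [hx.2])]
      rw [mem_sphere.1 hy] at hc1
      rw [mem_ball]
      nlinarith [hx.2]
  have hcb : ∀ x ∈ Icc (0 : ℝ) τ, w + x • e ∈ closedBall c ρ := fun x hx => by
    rcases hx.2.lt_or_eq with h | h
    · exact ball_subset_closedBall (hin x ⟨hx.1, h⟩)
    · rw [h, ← hyw]; exact sphere_subset_closedBall hy
  have hline : Continuous fun x : ℝ => w + x • e := by fun_prop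
  have hcount : ((fun x : ℝ => w + x • e) ⁻¹' S).Countable := by
    refine (hS.preimage ?_).countable
    intro a _ b _ hab
    exact smul_left_injective ℝ he (by simpa using hab)
  have hft := MeasureTheory.integral_eq_of_hasDerivAt_off_countable_of_le
    (fun x => max (t (w + x • e)) m') (fun _ => 0) hτ.le hcount
    ((ht.comp hline.continuousOn hcb).sup continuousOn_const) (fun x hx => by
      have hxU : w + x • e ∈ ball c ρ \ S := ⟨hin x ⟨hx.1.1.le, hx.1.2⟩, hx.2⟩
      have hl : HasDerivAt (fun x : ℝ => w + x • e) e x := by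
        simpa using ((hasDerivAt_id x).smul_const e).const_add w
      have hd := (htd _ hxU).comp_hasDerivAt x hl
      rcases lt_or_ge (t (w + x • e)) m' with h | h
      · refine (hasDerivAt_const x m').congr_of_eventuallyEq ?_
        filter_upwards [hd.continuousAt.eventually_lt_const h] with y hy
        exact max_eq_right hy.le
      · rw [hp0 _ hxU (hm1.trans_le h), map_zero, zero_apply] at hd
        rw [hasDerivAt_iff_isLittleO] at hd ⊢
        refine Asymptotics.IsBigO.trans_isLittleO (Asymptotics.IsBigO.of_bound 1 ?_) hd
        refine Eventually.of_forall fun y => ?_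
        simp only [smul_zero, sub_zero, one_mul, Real.norm_eq_abs, Function.comp_apply]
        exact abs_max_sub_max_le_abs _ _ _)
    (by simp)
  simp only [intervalIntegral.integral_zero, zero_smul, add_zero, ← hyw] at hft
  rw [max_eq_right ((hm y hy).trans hm1.le), max_eq_left hm2.le] at hft
  linarith

end MaxPrinciple

/-- The real linear map of the plane whose components have gradients `p` and `r`. -/
def gradientPairMap (p r : ℂ) : ℂ →L[ℝ] ℂ :=
  (Complex.equivRealProdCLM.symm : ℝ × ℝ →L[ℝ] ℂ) ∘L ((innerSL ℝ p).prod (innerSL ℝ r))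

theorem gradientPairMap_apply (p r w : ℂ) :
    gradientPairMap p r w = ⟨⟪p, w⟫, ⟪r, w⟫⟩ := by
  apply Complex.ext <;> simp [gradientPairMap]

theorem det_gradientPairMap (p r : ℂ) :
    (gradientPairMap p r).det = p.re * r.im - p.im * r.re := by
  change LinearMap.det (gradientPairMap p r : ℂ →ₗ[ℝ] ℂ) = _
  rw [← LinearMap.det_toMatrix Complex.basisOneI, Matrix.det_fin_two]
  simp [LinearMap.toMatrix_apply, gradientPairMap_apply, Complex.inner]

theorem continuous_gradientPairMap : Continuous fun x : ℂ × ℂ => gradientPairMap x.1 x.2 := by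
  have : (fun x : ℂ × ℂ => gradientPairMap x.1 x.2) = fun x =>
      (innerSL ℝ x.1).smulRight (1 : ℂ) + (innerSL ℝ x.2).smulRight Complex.I := by
    ext x w
    apply Complex.ext <;> simp [gradientPairMap_apply]
  rw [this]
  fun_prop

/-- The map of the plane with components `u` and `v`. -/
def pairMap (u v : ℂ → ℝ) (z : ℂ) : ℂ := ⟨u z, v z⟩

theorem HasFDerivAt.pairMap {u v : ℂ → ℝ} {p r z : ℂ} (hu : HasFDerivAt u (innerSL ℝ p) z)
    (hv : HasFDerivAt v (innerSL ℝ r) z) :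
    HasFDerivAt (pairMap u v) (gradientPairMap p r) z :=
  (Complex.equivRealProdCLM.symm : ℝ × ℝ →L[ℝ] ℂ).hasFDerivAt.comp z (hu.prodMk hv)

/-- A function `u` on a disc with gradient `V` vanishing only at the center, and a function `v`
whose gradient is `V` rotated by a right angle and rescaled to have length `α ‖V‖`, where `α` is
strictly increasing with `α 0 = 1`. -/
structure ConjugatePair (R : ℝ) (α : ℝ → ℝ) (u v : ℂ → ℝ) (V : ℂ → ℂ) : Prop where
  R_pos : 0 < R
  u_deriv : ∀ z ∈ ball (0 : ℂ) R, HasFDerivAt u (innerSL ℝ (V z)) z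
  V_cont : ContinuousOn V (ball 0 R)
  V_zero : V 0 = 0
  V_ne : ∀ z ∈ ball (0 : ℂ) R, z ≠ 0 → V z ≠ 0
  α_mono : StrictMonoOn α (Ici 0)
  α_cont : ContinuousOn α (Ici 0)
  α_zero : α 0 = 1
  v_deriv : ∀ z ∈ ball (0 : ℂ) R, z ≠ 0 →
    HasFDerivAt v (innerSL ℝ ((α ‖V z‖ / ‖V z‖ : ℝ) • (Complex.I * V z))) z
  v_lip : ∀ ε > 0, ∃ r > 0, r ≤ R ∧ ∀ a ∈ ball (0 : ℂ) r, ∀ b ∈ ball (0 : ℂ) r,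
    |v a - v b| ≤ (1 + ε) * ‖a - b‖

namespace ConjugatePair

variable {R : ℝ} {α : ℝ → ℝ} {u v : ℂ → ℝ} {V : ℂ → ℂ} (h : ConjugatePair R α u v V)
include h

theorem one_le_α {x : ℝ} (hx : 0 ≤ x) : 1 ≤ α x := by
  rw [← h.α_zero]
  exact h.α_mono.monotoneOn self_mem_Ici hx hx

theorem one_lt_α {x : ℝ} (hx : 0 < x) : 1 < α x := by
  rw [← h.α_zero]
  exact h.α_mono self_mem_Ici hx.le hx

theorem continuousOn_u : ContinuousOn u (ball 0 R) := fun z hz =>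
  (h.u_deriv z hz).continuousAt.continuousWithinAt

theorem continuousOn_v : ContinuousOn v (ball 0 R) := fun z hz => by
  refine ContinuousAt.continuousWithinAt ?_
  rcases eq_or_ne z 0 with rfl | hz0
  · obtain ⟨r, hr, -, hv⟩ := h.v_lip 1 one_pos
    refine LipschitzOnWith.continuousOn (K := 2)
      (LipschitzOnWith.of_dist_le_mul fun a ha b hb => ?_)
      |>.continuousAt (ball_mem_nhds (0 : ℂ) hr)
    have := hv a ha b hb
    rw [Real.dist_eq, dist_eq_norm]
    norm_num at this ⊢
    exact this
  · exact (h.v_deriv z hz hz0).continuousAt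

theorem continuousOn_pairMap : ContinuousOn (pairMap u v) (ball 0 R) :=
  (Complex.equivRealProdCLM.symm : ℝ × ℝ →L[ℝ] ℂ).continuous.comp_continuousOn
    (h.continuousOn_u.prodMk h.continuousOn_v)

theorem continuousOn_grad_v :
    ContinuousOn (fun z => (α ‖V z‖ / ‖V z‖ : ℝ) • (Complex.I * V z)) (ball 0 R \ {0}) := by
  have hV := h.V_cont.mono (sdiff_subset (t := {(0 : ℂ)}))
  have hα : ContinuousOn (fun z => α ‖V z‖) (ball 0 R \ {0}) :=
    h.α_cont.comp hV.norm fun z _ => norm_nonneg _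
  exact (hα.div hV.norm fun z hz => norm_ne_zero_iff.2 (h.V_ne z hz.1 hz.2)).smul
    (continuousOn_const.mul hV)

theorem jacobian_eq {z : ℂ} (hz : z ∈ ball (0 : ℂ) R) (hz0 : z ≠ 0) :
    (gradientPairMap (V z) ((α ‖V z‖ / ‖V z‖ : ℝ) • (Complex.I * V z))).det = α ‖V z‖ * ‖V z‖ := by
  have hq : ‖V z‖ ≠ 0 := norm_ne_zero_iff.2 (h.V_ne z hz hz0)
  rw [det_gradientPairMap]
  simp only [Complex.real_smul, Complex.mul_re, Complex.mul_im, Complex.ofReal_re,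
    Complex.ofReal_im, Complex.I_re, Complex.I_im]
  have h2 : ‖V z‖ * ‖V z‖ = (V z).re * (V z).re + (V z).im * (V z).im := by
    rw [Complex.norm_mul_self_eq_normSq, Complex.normSq_apply]
  field_simp
  linear_combination (-α ‖V z‖) * h2

theorem hasStrictFDerivAt {z : ℂ} (hz : z ∈ ball (0 : ℂ) R) (hz0 : z ≠ 0) :
    HasStrictFDerivAt (pairMap u v)
      (gradientPairMap (V z) ((α ‖V z‖ / ‖V z‖ : ℝ) • (Complex.I * V z))) z := by
  have hU : IsOpen (ball (0 : ℂ) R \ {0}) := isOpen_ball.sdiff isClosed_singleton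
  have hmem : ball (0 : ℂ) R \ {0} ∈ 𝓝 z := hU.mem_nhds ⟨hz, hz0⟩
  refine hasStrictFDerivAt_of_hasFDerivAt_of_continuousAt
    (f' := fun z => gradientPairMap (V z) ((α ‖V z‖ / ‖V z‖ : ℝ) • (Complex.I * V z))) ?_ ?_
  · filter_upwards [hmem] with y hy
    exact (h.u_deriv y hy.1).pairMap (h.v_deriv y hy.1 hy.2)
  · exact (continuous_gradientPairMap.comp_continuousOn
      ((h.V_cont.mono sdiff_subset).prodMk h.continuousOn_grad_v)).continuousAt hmem

/-- The derivative of `pairMap u v` at a noncritical point as a linear equivalence. -/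
theorem exists_equiv {z : ℂ} (hz : z ∈ ball (0 : ℂ) R) (hz0 : z ≠ 0) :
    ∃ e : ℂ ≃L[ℝ] ℂ, (e : ℂ →L[ℝ] ℂ) =
      gradientPairMap (V z) ((α ‖V z‖ / ‖V z‖ : ℝ) • (Complex.I * V z)) := by
  have hdet : (gradientPairMap (V z) ((α ‖V z‖ / ‖V z‖ : ℝ) • (Complex.I * V z))).det ≠ 0 := by
    rw [h.jacobian_eq hz hz0]
    have := h.one_le_α (norm_nonneg (V z))
    have := norm_pos_iff.2 (h.V_ne z hz hz0)
    positivity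
  exact ⟨ContinuousLinearMap.toContinuousLinearEquivOfDetNeZero _ hdet,
    ContinuousLinearMap.coe_toContinuousLinearEquivOfDetNeZero _ hdet⟩

theorem map_nhds_eq {z : ℂ} (hz : z ∈ ball (0 : ℂ) R) (hz0 : z ≠ 0) :
    map (pairMap u v) (𝓝 z) = 𝓝 (pairMap u v z) := by
  obtain ⟨e, he⟩ := h.exists_equiv hz hz0
  have hd := h.hasStrictFDerivAt hz hz0
  rw [← he] at hd
  exact hd.map_nhds_eq_of_equiv

/-- Away from the critical point one can move along the level line of `u`, with speed less than
one relative to the variation of `v`. -/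
theorem exists_level_step {z : ℂ} (hz : z ∈ ball (0 : ℂ) R) (hz0 : z ≠ 0) {σ : ℝ}
    (hσ : |σ| = 1) :
    ∀ᶠ τ in 𝓝[>] (0 : ℝ), ∃ y, ‖y - z‖ ≤ τ ∧ u y = u z ∧ v y = v z + σ * τ := by
  obtain ⟨e, he⟩ := h.exists_equiv hz hz0
  have hd := h.hasStrictFDerivAt hz hz0
  rw [← he] at hd
  have hq : 0 < ‖V z‖ := norm_pos_iff.2 (h.V_ne z hz hz0)
  have hα := h.one_lt_α hq
  set w : ℂ := (σ / (α ‖V z‖ * ‖V z‖) : ℝ) • (Complex.I * V z) with hw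
  have hew : e w = σ • Complex.I := by
    change (e : ℂ →L[ℝ] ℂ) w = _
    have h2 : ‖V z‖ * ‖V z‖ = (V z).re * (V z).re + (V z).im * (V z).im := by
      rw [Complex.norm_mul_self_eq_normSq, Complex.normSq_apply]
    rw [he, gradientPairMap_apply, hw]
    simp only [Complex.inner, Complex.real_smul]
    apply Complex.ext
    · simp only [Complex.mul_re, Complex.mul_im, Complex.ofReal_re, Complex.ofReal_im,
        Complex.I_re, Complex.I_im, Complex.conj_re, Complex.conj_im]
      ring
    · simp only [Complex.mul_re, Complex.mul_im, Complex.ofReal_re, Complex.ofReal_im,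
        Complex.I_re, Complex.I_im, Complex.conj_re, Complex.conj_im]
      field_simp
      linear_combination (-σ * α ‖V z‖) * h2
  have hwn : ‖w‖ < 1 := by
    rw [hw, norm_smul, norm_mul, Complex.norm_I, one_mul, Real.norm_eq_abs, abs_div, hσ,
      abs_of_pos (by positivity)]
    field_simp
    exact hα
  have hl : HasDerivAt (fun τ : ℝ => pairMap u v z + τ • (σ • Complex.I)) (σ • Complex.I) 0 := by
    simpa using ((hasDerivAt_id (0 : ℝ)).smul_const (σ • Complex.I)).const_add (pairMap u v z)
  have hG := hd.to_localInverse.hasFDerivAt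
  have hG' : HasFDerivAt (hd.localInverse (pairMap u v) e z) (e.symm : ℂ →L[ℝ] ℂ)
    (pairMap u v z + (0 : ℝ) • (σ • Complex.I)) := by simpa using hG
  have hγ := hG'.comp_hasDerivAt (0 : ℝ) hl
  have hsymm : (e.symm : ℂ →L[ℝ] ℂ) (σ • Complex.I) = w := by
    rw [← hew]; simp
  rw [hsymm] at hγ
  have hlim := hγ.tendsto_slope_zero_right
  have hnorm := hlim.norm.eventually_lt_const hwn
  have hinv : ∀ᶠ τ in 𝓝[>] (0 : ℝ), pairMap u v (hd.localInverse (pairMap u v) e z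
      (pairMap u v z + τ • (σ • Complex.I))) = pairMap u v z + τ • (σ • Complex.I) := by
    have hc : Tendsto (fun τ : ℝ => pairMap u v z + τ • (σ • Complex.I)) (𝓝[>] 0)
        (𝓝 (pairMap u v z)) := by
      simpa using hl.continuousAt.tendsto.mono_left nhdsWithin_le_nhds
    exact hc.eventually hd.eventually_right_inverse
  filter_upwards [hnorm, hinv, self_mem_nhdsWithin] with τ h1 h2 h3
  rw [mem_Ioi] at h3
  refine ⟨hd.localInverse (pairMap u v) e z (pairMap u v z + τ • (σ • Complex.I)), ?_, ?_, ?_⟩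
  · simp only [zero_add, Function.comp_apply, zero_smul, add_zero, hd.localInverse_apply_image,
      norm_smul, norm_inv, Real.norm_of_nonneg h3.le] at h1
    rw [inv_mul_lt_iff₀ h3, mul_one] at h1
    exact h1.le
  · simpa [pairMap] using congrArg Complex.re h2
  · have := congrArg Complex.im h2
    refine this.trans ?_
    simp [pairMap, mul_comm]

/-- The level line of `u` through a point off the critical level contains, within distance `s`,
points where `v` has varied by exactly `s`. -/
theorem exists_level_point {z₀ : ℂ} {s : ℝ} (hs : 0 ≤ s) (hball : closedBall z₀ s ⊆ ball 0 R)
    (hne : u z₀ ≠ u 0) {σ : ℝ} (hσ : |σ| = 1) :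
    ∃ z ∈ closedBall z₀ s, u z = u z₀ ∧ v z = v z₀ + σ * s := by
  have hσ2 : σ * σ = 1 := by rw [← abs_mul_abs_self, hσ, one_mul]
  have hcu := h.continuousOn_u.mono hball
  have hcv := h.continuousOn_v.mono hball
  set K : Set ℂ := {z ∈ closedBall z₀ s | u z = u z₀ ∧
    ‖z - z₀‖ ≤ σ * (v z - v z₀) ∧ σ * (v z - v z₀) ≤ s} with hKdef
  have hK : IsCompact K := by
    have hcw : ContinuousOn (fun z => σ * (v z - v z₀)) (closedBall z₀ s) := by fun_prop
    have hcn : ContinuousOn (fun z => ‖z - z₀‖ - σ * (v z - v z₀)) (closedBall z₀ s) := by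
      fun_prop
    have h1 := hcu.preimage_isClosed_of_isClosed isClosed_closedBall
      (isClosed_singleton (x := u z₀))
    have h2 := hcn.preimage_isClosed_of_isClosed isClosed_closedBall (isClosed_Iic (a := (0:ℝ)))
    have h3 := hcw.preimage_isClosed_of_isClosed isClosed_closedBall (isClosed_Iic (a := s))
    refine (isCompact_closedBall z₀ s).of_isClosed_subset ?_ fun z hz => hz.1
    convert (h1.inter h2).inter h3 using 1
    ext z
    simp only [hKdef, mem_ofPred_eq, mem_inter_iff, mem_preimage, mem_Iic, mem_singleton_iff,
      sub_nonpos]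
    tauto
  have hz₀ : z₀ ∈ K := ⟨mem_closedBall_self hs, rfl, by simp, by simpa using hs⟩
  obtain ⟨y, hy, hmax⟩ := hK.exists_isMaxOn ⟨z₀, hz₀⟩
    (f := fun z => σ * v z) (continuousOn_const.mul (hcv.mono fun z hz => hz.1))
  refine ⟨y, hy.1, hy.2.1, ?_⟩
  rcases hy.2.2.2.lt_or_eq with hlt | heq
  · exfalso
    have hyR := hball hy.1
    have hy0 : y ≠ 0 := by
      rintro rfl
      exact hne hy.2.1.symm
    obtain ⟨τ, ⟨x, hx1, hx2, hx3⟩, hτ⟩ := ((h.exists_level_step hyR hy0 hσ).and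
      (Ioo_mem_nhdsGT (sub_pos.2 hlt))).exists
    have hvx : σ * (v x - v z₀) = σ * (v y - v z₀) + τ := by
      rw [hx3]; linear_combination τ * hσ2
    have hxn : ‖x - z₀‖ ≤ σ * (v x - v z₀) := by
      rw [hvx]
      have := norm_sub_le_norm_sub_add_norm_sub x y z₀
      linarith [hy.2.2.1]
    have hxs : σ * (v x - v z₀) ≤ s := by rw [hvx]; linarith [hτ.2]
    have hxK : x ∈ K :=
      ⟨mem_closedBall_iff_norm.2 (hxn.trans hxs), hx2.trans hy.2.1, hxn, hxs⟩
    have := hmax hxK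
    simp only [mem_ofPred_eq] at this
    nlinarith [hτ.1]
  · linear_combination (-(v y - v z₀)) * hσ2 + σ * heq

end ConjugatePair

theorem volume_complex_box (s t : Set ℝ) :
    volume {w : ℂ | w.re ∈ s ∧ w.im ∈ t} = volume s * volume t := by
  have h := Complex.volume_preserving_equiv_real_prod.measure_preimage_equiv (s ×ˢ t)
  rw [Measure.volume_eq_prod, Measure.prod_prod] at h
  exact h

/-- The intersection of a strip with a disc centered on its axis has area at most that of a
rectangle. -/
theorem volume_strip_inter_closedBall_le {e : ℂ} (he : ‖e‖ = 1) (z₁ : ℂ) {a b : ℝ} (ha : 0 ≤ a) :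
    volume {z ∈ closedBall z₁ b | |⟪e, z - z₁⟫| ≤ a} ≤ ENNReal.ofReal (4 * a * b) := by
  let ρ : ℂ ≃ₗᵢ[ℝ] ℂ := rotation ⟨e, by simpa [Submonoid.unitSphere] using he⟩
  have hρ : MeasurePreserving (fun z : ℂ => ρ z + z₁) := by
    exact (measurePreserving_add_right volume z₁).comp ρ.measurePreserving
  have hmeas : MeasurableSet {z ∈ closedBall z₁ b | |⟪e, z - z₁⟫| ≤ a} := by
    have h1 : IsClosed {z : ℂ | |⟪e, z - z₁⟫| ≤ a} := isClosed_le (by fun_prop) continuous_const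
    exact (isClosed_closedBall.inter h1).measurableSet
  rw [← hρ.measure_preimage hmeas.nullMeasurableSet]
  calc _ ≤ volume {w : ℂ | w.re ∈ Icc (-a) a ∧ w.im ∈ Icc (-b) b} := by
        refine measure_mono fun z hz => ?_
        simp only [mem_preimage, mem_ofPred_eq, mem_closedBall, dist_add_self_left,
          add_sub_cancel_right, LinearIsometryEquiv.norm_map] at hz
        have hin : ⟪e, ρ z⟫ = z.re := by
          have h1 : ρ z = e * z := rfl
          have h2 : (starRingEnd ℂ) e * e = 1 := by
            rw [Complex.conj_mul', he]; norm_num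
          rw [h1, Complex.inner, mul_right_comm, mul_comm e, h2, one_mul]
        rw [hin] at hz
        exact ⟨abs_le.1 hz.2, abs_le.1 ((Complex.abs_im_le_norm z).trans hz.1)⟩
    _ = ENNReal.ofReal (4 * a * b) := by
        rw [volume_complex_box, Real.volume_Icc, Real.volume_Icc,
          ← ENNReal.ofReal_mul (by linarith)]
        congr 1
        ring

/-- A bounded primitive of a continuous plateau function. -/
theorem exists_plateau_primitive {a : ℝ} (ha : 0 < a) :
    ∃ G φ : ℝ → ℝ, (∀ x, HasDerivAt G (φ x) x) ∧ (∀ x, 0 ≤ φ x) ∧ (∀ x, φ x ≤ 1) ∧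
      (∀ x, |x| ≤ a → φ x = 1) ∧ (∀ x, 11 / 10 * a ≤ |x| → φ x = 0) ∧
      ∀ x, |G x| ≤ 11 / 10 * a := by
  let φ : ℝ → ℝ := fun x => max 0 (min 1 (11 - 10 * |x| / a))
  have hφ : Continuous φ := by fun_prop
  have h0 : ∀ x, 0 ≤ φ x := fun x => le_max_left _ _
  have h1 : ∀ x, φ x ≤ 1 := fun x => max_le zero_le_one (min_le_left _ _)
  have hz : ∀ x, 11 / 10 * a ≤ |x| → φ x = 0 := fun x hx => by
    have : 11 - 10 * |x| / a ≤ 0 := by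
      rw [sub_nonpos, le_div_iff₀ ha]; linarith
    exact max_eq_left ((min_le_right _ _).trans this)
  have hd : ∀ x, HasDerivAt (fun x => ∫ t in (0 : ℝ)..x, φ t) (φ x) x := fun x =>
    hφ.integral_hasStrictDerivAt 0 x |>.hasDerivAt
  refine ⟨fun x => ∫ t in (0 : ℝ)..x, φ t, φ, hd, h0, h1, fun x hx => ?_, hz, fun x => ?_⟩
  · have : 1 ≤ 11 - 10 * |x| / a := by
      have : 10 * |x| / a ≤ 10 := by rw [div_le_iff₀ ha]; linarith
      linarith
    simp [φ, min_eq_left this]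
  · set A := 11 / 10 * a with hA
    have hA0 : 0 < A := by positivity
    have hnear : ∀ y, |y| ≤ A → |∫ t in (0 : ℝ)..y, φ t| ≤ A := fun y hy => by
      have := intervalIntegral.norm_integral_le_of_norm_le_const (a := 0) (b := y) (f := φ) (C := 1)
        fun t _ => by rw [Real.norm_of_nonneg (h0 t)]; exact h1 t
      rw [Real.norm_eq_abs, sub_zero, one_mul] at this
      exact this.trans hy
    have hfar : ∀ y z, (∀ t ∈ uIoc y z, A ≤ |t|) →
        ∫ t in (0 : ℝ)..z, φ t = ∫ t in (0 : ℝ)..y, φ t := fun y z hyz => by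
      rw [← intervalIntegral.integral_add_adjacent_intervals (hφ.intervalIntegrable 0 y)
        (hφ.intervalIntegrable y z)]
      rw [intervalIntegral.integral_zero_ae (Eventually.of_forall fun t ht => hz t (hyz t ht)),
        add_zero]
    change |∫ t in (0 : ℝ)..x, φ t| ≤ A
    rcases le_total |x| A with hx | hx
    · exact hnear x hx
    · rcases le_abs.1 hx with h | h
      · rw [hfar A x fun t ht => ?_]
        · exact hnear A (abs_of_pos hA0).le
        · rw [uIoc_of_le h] at ht
          exact ht.1.le.trans (le_abs_self t)
      · rw [hfar (-A) x fun t ht => ?_]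
        · exact hnear (-A) (by rw [abs_neg, abs_of_pos hA0])
        · rw [uIoc_of_ge (by linarith)] at ht
          exact le_abs.2 (Or.inr (by linarith [ht.2]))

/-- If a function is nearly `1`-Lipschitz and varies at full speed from `z₁` to two far away points
`p` and `m` with opposite signs, then its level sets near `z₁` are nearly straight. -/
theorem exists_direction_of_almost_lipschitz {v : ℂ → ℝ} {B : Set ℂ}
    (hv : ∀ a ∈ B, ∀ b ∈ B, |v a - v b| ≤ (1 + 1 / 10 ^ 8) * ‖a - b‖) {z₁ p m : ℂ} {d : ℝ}
    (hd : 0 < d) (hz₁ : z₁ ∈ B) (hp : p ∈ B) (hm : m ∈ B) (hp1 : ‖p - z₁‖ ≤ 3000 * d)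
    (hm1 : ‖m - z₁‖ ≤ 3000 * d) (hvp : v p = v z₁ + 3000 * d) (hvm : v m = v z₁ - 3000 * d) :
    ∃ e : ℂ, ‖e‖ = 1 ∧ ∀ z ∈ B, ‖z - z₁‖ ≤ 9 * d → |v z - v z₁| ≤ 11 / 40 * d →
      |⟪e, z - z₁⟫| ≤ 61 / 200 * d := by
  set P := p - z₁ with hP
  set M := m - z₁ with hM
  have hPlow : 2999 * d ≤ ‖P‖ := by
    have := hv p hp z₁ hz₁
    rw [hvp, add_sub_cancel_left, abs_of_pos (by positivity), ← hP] at this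
    linarith
  have hPpos : 0 < ‖P‖ := by linarith
  have hsum : ‖P + M‖ ≤ 9 / 10 * d := by
    have h1 : 6000 * d ≤ (1 + 1 / 10 ^ 8) * ‖P - M‖ := by
      have := hv p hp m hm
      rw [hvp, hvm, show v z₁ + 3000 * d - (v z₁ - 3000 * d) = 6000 * d by ring,
        abs_of_pos (by positivity), show p - m = P - M by rw [hP, hM]; ring] at this
      exact this
    have h2 := parallelogram_law_with_norm ℝ P M
    have h3 : (6000 - 6000 / 10 ^ 8) * d ≤ ‖P - M‖ := by
      have : (1 - 1 / 10 ^ 8) * (6000 * d) ≤ (1 - 1 / 10 ^ 8) * ((1 + 1 / 10 ^ 8) * ‖P - M‖) :=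
        mul_le_mul_of_nonneg_left h1 (by norm_num)
      nlinarith [norm_nonneg (P - M)]
    have h4 : ((6000 - 6000 / 10 ^ 8) * d) ^ 2 ≤ ‖P - M‖ ^ 2 := by gcongr
    have h5 : ‖P‖ ^ 2 ≤ (3000 * d) ^ 2 := by gcongr
    have h6 : ‖M‖ ^ 2 ≤ (3000 * d) ^ 2 := by gcongr
    refine abs_le_of_sq_le_sq' ?_ (by positivity) |>.2
    nlinarith
  refine ⟨(‖P‖⁻¹ : ℝ) • P, by rw [norm_smul, norm_inv, norm_norm, inv_mul_cancel₀ hPpos.ne'],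
    fun z hz hzd hvz => ?_⟩
  set y := z - z₁ with hy
  have key : ∀ Q : ℂ, ‖Q‖ ≤ 3000 * d →
      ‖y - Q‖ ≤ 3000 * d - ⟪Q, y⟫ / (3000 * d) + 27 / 2000 * d := fun Q hQ => by
    have h1 := norm_sub_sq_real y Q
    rw [real_inner_comm] at h1
    have h2 : ‖y‖ ^ 2 ≤ (9 * d) ^ 2 := by gcongr
    have h3 : ‖Q‖ ^ 2 ≤ (3000 * d) ^ 2 := by gcongr
    have h4 : ⟪Q, y⟫ = ⟪Q, y⟫ / (3000 * d) * (3000 * d) := by field_simp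
    set x := ⟪Q, y⟫ / (3000 * d)
    have h5 : 2 * ‖y - Q‖ * (3000 * d) ≤ ‖y - Q‖ ^ 2 + (3000 * d) ^ 2 := two_mul_le_add_sq _ _
    have h6 : ‖y - Q‖ * (6000 * d) ≤ (3000 * d - x + 27 / 2000 * d) * (6000 * d) := by nlinarith
    exact le_of_mul_le_mul_right h6 (by positivity)
  have hbd : ∀ Q : ℂ, ‖Q‖ ≤ 3000 * d → ‖y - Q‖ ≤ 3009 * d := fun Q hQ =>
    (norm_sub_le _ _).trans (by linarith)
  have hyP : z - p = y - P := by rw [hy, hP]; ring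
  have hyM : z - m = y - M := by rw [hy, hM]; ring
  have e1 := abs_le.1 (hv z hz p hp)
  have e2 := abs_le.1 (hv z hz m hm)
  rw [hyP, hvp] at e1
  rw [hyM, hvm] at e2
  have k1 := key P hp1
  have k2 := key M hm1
  have b1 := hbd P hp1
  have b2 := hbd M hm1
  have hvz' := abs_le.1 hvz
  have hPM : |⟪P, y⟫ + ⟪M, y⟫| ≤ 81 / 10 * d * d := by
    rw [← inner_add_left]
    refine (abs_real_inner_le_norm _ _).trans ?_
    calc ‖P + M‖ * ‖y‖ ≤ 9 / 10 * d * (9 * d) := by gcongr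
      _ = _ := by ring
  have hPM' : |⟪P, y⟫ / (3000 * d) + ⟪M, y⟫ / (3000 * d)| ≤ 27 / 10000 * d := by
    rw [← add_div, abs_div, abs_of_pos (by positivity : 0 < 3000 * d), div_le_iff₀ (by positivity)]
    nlinarith
  have hfin : |⟪P, y⟫ / (3000 * d)| ≤ 3 / 10 * d := by
    rw [abs_le] at hPM' ⊢
    constructor <;> linarith [hPM'.1, hPM'.2, e1.1, e2.2, hvz'.1, hvz'.2]
  rw [abs_div, abs_of_pos (by positivity : 0 < 3000 * d), div_le_iff₀ (by positivity)] at hfin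
  rw [real_inner_smul_left, abs_mul, abs_of_pos (inv_pos.2 hPpos), inv_mul_le_iff₀ hPpos]
  nlinarith

theorem LipschitzWith.mul_of_bounded {A B : ℂ → ℝ} {CA CB a b : NNReal} (hA : LipschitzWith CA A)
    (hB : LipschitzWith CB B) (ha : ∀ z, |A z| ≤ a) (hb : ∀ z, |B z| ≤ b) :
    LipschitzWith (a * CB + b * CA) fun z => A z * B z := by
  refine LipschitzWith.of_dist_le_mul fun x y => ?_
  have h1 := hA.dist_le_mul x y
  have h2 := hB.dist_le_mul x y
  rw [Real.dist_eq] at h1 h2 ⊢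
  have h3 : A x * B x - A y * B y = A x * (B x - B y) + B y * (A x - A y) := by ring
  rw [h3]
  refine (abs_add_le _ _).trans ?_
  rw [abs_mul, abs_mul]
  push_cast
  calc |A x| * |B x - B y| + |B y| * |A x - A y| ≤ a * (CB * dist x y) + b * (CA * dist x y) := by
        gcongr
        · exact ha x
        · exact hb y
    _ = _ := by ring

theorem lipschitzWith_one_of_hasDerivAt {G φ : ℝ → ℝ} (hG : ∀ x, HasDerivAt G (φ x) x)
    (h0 : ∀ x, 0 ≤ φ x) (h1 : ∀ x, φ x ≤ 1) : LipschitzWith 1 G :=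
  lipschitzWith_of_nnnorm_deriv_le (fun x => (hG x).differentiableAt) fun x => by
    rw [(hG x).deriv, ← NNReal.coe_le_coe, coe_nnnorm, Real.norm_of_nonneg (h0 x)]
    exact h1 x

/-- A radial Lipschitz cutoff function. -/
theorem exists_radial_cutoff (z₁ : ℂ) {d : ℝ} (hd : 0 < d) :
    ∃ χ : ℂ → ℝ, LipschitzWith (Real.toNNReal (2 / (15 * d))) χ ∧ (∀ z, 0 ≤ χ z) ∧
      (∀ z, χ z ≤ 1) ∧ (∀ z, dist z z₁ ≤ 3 / 2 * d → χ z = 1) ∧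
      ∀ z, 9 * d ≤ dist z z₁ → χ z = 0 := by
  have hlin : LipschitzWith (Real.toNNReal (2 / (15 * d)))
      fun z : ℂ => (9 * d - dist z z₁) * (2 / (15 * d)) := by
    refine LipschitzWith.of_dist_le_mul fun x y => ?_
    rw [Real.coe_toNNReal _ (by positivity), Real.dist_eq, ← sub_mul, abs_mul,
      abs_of_pos (by positivity : 0 < 2 / (15 * d)), mul_comm]
    gcongr
    have : 9 * d - dist x z₁ - (9 * d - dist y z₁) = dist y z₁ - dist x z₁ := by ring
    rw [this, dist_comm x y]
    exact abs_dist_sub_le _ _ _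
  refine ⟨fun z => max (min ((9 * d - dist z z₁) * (2 / (15 * d))) 1) 0,
    (hlin.min_const 1).max_const 0, fun z => le_max_right _ _,
    fun z => max_le (min_le_right _ _) zero_le_one, fun z hz => ?_, fun z hz => ?_⟩
  · have : 1 ≤ (9 * d - dist z z₁) * (2 / (15 * d)) := by
      rw [mul_div, le_div_iff₀ (by positivity)]; linarith
    simp [min_eq_right this]
  · have : (9 * d - dist z z₁) * (2 / (15 * d)) ≤ 0 :=
      mul_nonpos_of_nonpos_of_nonneg (by linarith) (by positivity)
    exact max_eq_right ((min_le_left _ _).trans this)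

namespace ConjugatePair

variable {R : ℝ} {α : ℝ → ℝ} {u v : ℂ → ℝ} {V : ℂ → ℂ} (h : ConjugatePair R α u v V)
include h

/-- The area, with multiplicity, of the part of the image of `pairMap u v` lying in a small window
is controlled by the variation of `u` and the area of a neighborhood of a level line of `v`. -/
theorem lintegral_jacobian_le {r : ℝ} (hrR : r ≤ R)
    (hv : ∀ a ∈ ball (0 : ℂ) r, ∀ b ∈ ball (0 : ℂ) r, |v a - v b| ≤ (1 + 1 / 10 ^ 8) * ‖a - b‖)
    {z₁ : ℂ} {d τ : ℝ} (hd : 0 < d) (hτ : 0 < τ) (hball : closedBall z₁ (10 * d) ⊆ ball 0 r)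
    {E : Set ℂ} (hEm : MeasurableSet E) (hE : ∀ z ∈ E, dist z z₁ ≤ 3 / 2 * d)
    (hEu : ∀ z ∈ E, |u z - u z₁| ≤ τ) (hEv : ∀ z ∈ E, |v z - v z₁| ≤ d / 4) :
    ∫⁻ z in E, ENNReal.ofReal
      |(gradientPairMap (V z) ((α ‖V z‖ / ‖V z‖ : ℝ) • (Complex.I * V z))).det| ≤
    ENNReal.ofReal (11 / 10 * τ * (2 / (15 * d)) * (1 + 1 / 10 ^ 8)) *
      volume {z ∈ closedBall z₁ (9 * d) | |v z - v z₁| ≤ 11 / 40 * d} := by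
  have hball' : closedBall z₁ (10 * d) ⊆ ball 0 R := hball.trans (ball_subset_ball hrR)
  set Y : ℂ → ℂ := fun z => (α ‖V z‖ / ‖V z‖ : ℝ) • (Complex.I * V z) with hY
  set C₁ : NNReal := Real.toNNReal (1 + 1 / 10 ^ 8) with hC₁
  have hvL : LipschitzOnWith C₁ v (ball 0 r) := LipschitzOnWith.of_dist_le_mul fun a ha b hb => by
    rw [hC₁, Real.coe_toNNReal _ (by norm_num), Real.dist_eq, dist_eq_norm]
    exact hv a ha b hb
  obtain ⟨v', hv'L, hv'⟩ := hvL.extend_real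
  obtain ⟨CV, hCV⟩ := (isCompact_closedBall z₁ (10 * d)).exists_bound_of_continuousOn
    (h.V_cont.mono hball')
  have huL : LipschitzOnWith (Real.toNNReal CV) u (closedBall z₁ (10 * d)) := by
    refine Convex.lipschitzOnWith_of_nnnorm_hasFDerivWithin_le
      (f' := fun z => innerSL ℝ (V z)) (fun z hz => (h.u_deriv z (hball' hz)).hasFDerivWithinAt)
      (fun z hz => ?_) (convex_closedBall _ _)
    rw [← NNReal.coe_le_coe, coe_nnnorm, innerSL_apply_norm]
    exact (hCV z hz).trans (Real.le_coe_toNNReal _)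
  obtain ⟨u', hu'L, hu'⟩ := huL.extend_real
  obtain ⟨G, φ, hG, hφ0, hφ1, hφone, -, hGb⟩ := exists_plateau_primitive hτ
  obtain ⟨Ψ, ψ, hΨ, hψ0, hψ1, hψone, hψz, hΨb⟩ := exists_plateau_primitive (half_pos (half_pos hd))
  obtain ⟨χ, hχL, hχ0, hχ1, hχone, hχz⟩ := exists_radial_cutoff z₁ hd
  have hGL : LipschitzWith _ fun z => G (u' z - u z₁) :=
    (lipschitzWith_one_of_hasDerivAt hG hφ0 hφ1).comp (hu'L.sub (LipschitzWith.const (u z₁)))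
  have hBL : LipschitzWith _ fun z => Ψ (v' z - v z₁) :=
    (lipschitzWith_one_of_hasDerivAt hΨ hψ0 hψ1).comp (hv'L.sub (LipschitzWith.const (v z₁)))
  have hAL := hχL.mul_of_bounded hGL (a := 1) (b := Real.toNNReal (11 / 10 * τ))
    (fun z => by rw [abs_of_nonneg (hχ0 z)]; exact hχ1 z)
    (fun z => by rw [Real.coe_toNNReal _ (by positivity)]; exact hGb _)
  have hAs : HasCompactSupport fun z => χ z * G (u' z - u z₁) :=
    HasCompactSupport.intro (isCompact_closedBall z₁ (9 * d)) fun z hz => by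
      rw [hχz z (not_le.1 hz).le, zero_mul]
  obtain ⟨hint, hzero⟩ := integrable_jacobian_and_integral_eq_zero hAL hBL hAs
  set jac : ℂ → ℝ := fun z => fderiv ℝ (fun z => χ z * G (u' z - u z₁)) z 1 *
    fderiv ℝ (fun z => Ψ (v' z - v z₁)) z Complex.I -
    fderiv ℝ (fun z => χ z * G (u' z - u z₁)) z Complex.I *
    fderiv ℝ (fun z => Ψ (v' z - v z₁)) z 1 with hjac
  set T : Set ℂ := {z ∈ closedBall z₁ (9 * d) | |v z - v z₁| ≤ 11 / 40 * d} with hT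
  have hTm : MeasurableSet T := by
    have hvc : ContinuousOn (fun z => |v z - v z₁|) (closedBall z₁ (9 * d)) :=
      ((h.continuousOn_v.mono ((closedBall_subset_closedBall (by linarith)).trans hball')).sub
        continuousOn_const).abs
    exact (hvc.preimage_isClosed_of_isClosed isClosed_closedBall
      (isClosed_Iic (a := 11 / 40 * d))).measurableSet
  set M : ℝ := 11 / 10 * τ * (2 / (15 * d)) * (1 + 1 / 10 ^ 8) with hM
  have hM0 : 0 ≤ M := by positivity
  have hTfin : volume T ≠ ⊤ :=
    ((measure_mono fun z hz => hz.1).trans_lt measure_closedBall_lt_top).ne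
  have hpt : ∀ᵐ z, E.indicator (fun z => |(gradientPairMap (V z) (Y z)).det|) z ≤
      jac z + T.indicator (fun _ => M) z := by
    filter_upwards [hχL.ae_differentiableAt, compl_mem_ae_iff.2 (measure_singleton (0 : ℂ))]
      with z hχd hz0
    by_cases hz : dist z z₁ < 10 * d
    · have hzb : ball z₁ (10 * d) ∈ 𝓝 z := isOpen_ball.mem_nhds hz
      have hzR : z ∈ ball (0 : ℂ) R := hball' (ball_subset_closedBall hz)
      have hzr : z ∈ ball (0 : ℂ) r := hball (ball_subset_closedBall hz)
      have eu : u' =ᶠ[𝓝 z] u := by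
        filter_upwards [hzb] with y hy using (hu' (ball_subset_closedBall hy)).symm
      have ev : v' =ᶠ[𝓝 z] v := by
        filter_upwards [hzb] with y hy using (hv' (hball (ball_subset_closedBall hy))).symm
      have du : HasFDerivAt (fun z => G (u' z - u z₁)) (φ (u z - u z₁) • innerSL ℝ (V z)) z := by
        have h1 := ((h.u_deriv z hzR).congr_of_eventuallyEq eu).sub_const (u z₁)
        rw [← eu.eq_of_nhds]
        exact (hG _).comp_hasFDerivAt z h1
      have dv : HasFDerivAt (fun z => Ψ (v' z - v z₁)) (ψ (v z - v z₁) • innerSL ℝ (Y z)) z := by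
        have h1 := ((h.v_deriv z hzR hz0).congr_of_eventuallyEq ev).sub_const (v z₁)
        rw [← ev.eq_of_nhds]
        exact (hΨ _).comp_hasFDerivAt z h1
      have dA : HasFDerivAt (fun z => χ z * G (u' z - u z₁)) _ z := hχd.hasFDerivAt.mul du
      have hYn : ‖Y z‖ ≤ 1 + 1 / 10 ^ 8 := by
        have := (h.v_deriv z hzR hz0).le_of_lipschitzOn (isOpen_ball.mem_nhds hzr) hvL
        rw [innerSL_apply_norm, hC₁, Real.coe_toNNReal _ (by norm_num)] at this
        exact this
      have hdet : (gradientPairMap (V z) (Y z)).det = (V z).re * (Y z).im - (V z).im * (Y z).re :=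
        det_gradientPairMap _ _
      have hdet0 : 0 ≤ (gradientPairMap (V z) (Y z)).det := by
        rw [h.jacobian_eq hzR hz0]
        have := h.one_le_α (norm_nonneg (V z))
        positivity
      have hG' : G (u' z - u z₁) = G (u z - u z₁) := by rw [eu.eq_of_nhds]
      have hform : jac z = χ z * φ (u z - u z₁) * ψ (v z - v z₁) * (gradientPairMap (V z) (Y z)).det
          + G (u z - u z₁) * ψ (v z - v z₁) * fderiv ℝ χ z (-(Complex.I * Y z)) := by
        have hlin : fderiv ℝ χ z (-(Complex.I * Y z)) =
            (Y z).im * fderiv ℝ χ z 1 - (Y z).re * fderiv ℝ χ z Complex.I := by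
          have : -(Complex.I * Y z) = (Y z).im • (1 : ℂ) - (Y z).re • Complex.I := by
            apply Complex.ext <;> simp
          rw [this, map_sub, map_smul, map_smul, smul_eq_mul, smul_eq_mul]
        rw [hlin, hdet]
        simp only [hjac]
        rw [dA.fderiv, dv.fderiv]
        simp only [add_apply, smul_apply, innerSL_apply_one, innerSL_apply_I, smul_eq_mul, hG']
        ring
      have hfirst : E.indicator (fun z => |(gradientPairMap (V z) (Y z)).det|) z ≤
          χ z * φ (u z - u z₁) * ψ (v z - v z₁) * (gradientPairMap (V z) (Y z)).det := by
        by_cases hzE : z ∈ E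
        · rw [indicator_of_mem hzE, hχone z (hE z hzE), hφone _ (hEu z hzE),
            hψone _ ((hEv z hzE).trans_eq (by ring)), abs_of_nonneg hdet0]
          linarith
        · rw [indicator_of_notMem hzE]
          exact mul_nonneg (mul_nonneg (mul_nonneg (hχ0 z) (hφ0 _)) (hψ0 _)) hdet0
      have hsecond : -T.indicator (fun _ => M) z ≤
          G (u z - u z₁) * ψ (v z - v z₁) * fderiv ℝ χ z (-(Complex.I * Y z)) := by
        by_cases hzT : z ∈ T
        · rw [indicator_of_mem hzT]
          refine neg_le_of_abs_le ?_
          have h1 : |fderiv ℝ χ z (-(Complex.I * Y z))| ≤ 2 / (15 * d) * (1 + 1 / 10 ^ 8) := by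
            have hχn := norm_fderiv_le_of_lipschitz ℝ hχL (x₀ := z)
            rw [Real.coe_toNNReal _ (by positivity)] at hχn
            refine ((fderiv ℝ χ z).le_of_opNorm_le hχn _).trans ?_
            rw [norm_neg, norm_mul, Complex.norm_I, one_mul]
            gcongr
          rw [abs_mul, abs_mul, abs_of_nonneg (hψ0 _)]
          calc _ ≤ 11 / 10 * τ * 1 * (2 / (15 * d) * (1 + 1 / 10 ^ 8)) := by
                gcongr
                · exact hψ0 _
                · exact hGb _
                · exact hψ1 _
            _ = M := by rw [hM]; ring
        · rw [indicator_of_notMem hzT, neg_zero]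
          by_cases hz9 : dist z z₁ ≤ 9 * d
          · have : 11 / 40 * d < |v z - v z₁| := by
              by_contra hcon
              exact hzT ⟨hz9, not_lt.1 hcon⟩
            rw [hψz _ (by linarith)]
            simp
          · have hχe : χ =ᶠ[𝓝 z] fun _ => 0 := by
              filter_upwards [(continuous_dist.comp (Continuous.prodMk_left z₁)).continuousAt
                |>.eventually_const_lt (not_le.1 hz9)] with y hy
              exact hχz y (le_of_lt hy)
            rw [hχe.fderiv_eq]
            simp
      rw [hform]
      linarith
    · have hzE : z ∉ E := fun hzE => hz ((hE z hzE).trans_lt (by linarith))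
      have hAe : (fun z => χ z * G (u' z - u z₁)) =ᶠ[𝓝 z] fun _ => 0 := by
        have hz9 : 9 * d < dist z z₁ := by linarith
        filter_upwards [(continuous_dist.comp (Continuous.prodMk_left z₁)).continuousAt
          |>.eventually_const_lt hz9] with y hy
        rw [hχz y (le_of_lt hy), zero_mul]
      have : jac z = 0 := by
        simp only [hjac]
        rw [hAe.fderiv_eq]
        simp
      rw [indicator_of_notMem hzE, this, zero_add]
      exact indicator_nonneg (fun _ _ => hM0) z
  have hTint : Integrable (T.indicator fun _ => M) :=
    (integrable_indicator_iff hTm).2 (integrableOn_const hTfin)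
  have hsum0 : 0 ≤ᵐ[volume] fun z => jac z + T.indicator (fun _ => M) z := by
    filter_upwards [hpt] with z hz
    exact (indicator_nonneg (fun _ _ => abs_nonneg _) z).trans hz
  calc _ = ∫⁻ z, E.indicator (fun z => ENNReal.ofReal |(gradientPairMap (V z) (Y z)).det|) z :=
        (lintegral_indicator hEm _).symm
    _ ≤ ∫⁻ z, ENNReal.ofReal (jac z + T.indicator (fun _ => M) z) := by
        refine lintegral_mono_ae ?_
        filter_upwards [hpt] with z hz
        refine le_trans (le_of_eq ?_) (ENNReal.ofReal_le_ofReal hz)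
        by_cases hzE : z ∈ E <;> simp [hzE]
    _ = ENNReal.ofReal (∫ z, jac z + T.indicator (fun _ => M) z) :=
        (ofReal_integral_eq_lintegral_ofReal (hint.add hTint) hsum0).symm
    _ = ENNReal.ofReal M * volume T := by
        rw [integral_add hint hTint, hzero, zero_add, integral_indicator_const _ hTm, smul_eq_mul,
          mul_comm, ENNReal.ofReal_mul hM0, measureReal_def, ENNReal.ofReal_toReal hTfin]

end ConjugatePair

namespace ConjugatePair

variable {R : ℝ} {α : ℝ → ℝ} {u v : ℂ → ℝ} {V : ℂ → ℂ} (h : ConjugatePair R α u v V)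
include h

/-- The image of a disc of radius `3 / 10 * d` contains a thin box of height `d / 2`. -/
theorem eventually_window_subset_image {z : ℂ} (hz0 : z ≠ 0) {d : ℝ} (hd : 0 < d)
    (hball : closedBall z d ⊆ ball 0 R) (hne : u z ≠ u 0) :
    ∀ᶠ τ in 𝓝[>] (0 : ℝ), ∀ w : ℂ, |w.re - u z| < τ → |w.im - v z| < d / 4 →
      ∃ y ∈ ball z (3 / 10 * d), y ≠ 0 ∧ pairMap u v y = w := by
  have hz : z ∈ ball (0 : ℂ) R := hball (mem_closedBall_self hd.le)
  have hopen : pairMap u v '' ball z (d / 100) ∈ 𝓝 (pairMap u v z) := by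
    rw [← h.map_nhds_eq hz hz0]
    exact image_mem_map (ball_mem_nhds z (by positivity))
  obtain ⟨ε, hε, hεs⟩ := Metric.mem_nhds_iff.1 hopen
  have hpos : 0 < |u z - u 0| := abs_pos.2 (sub_ne_zero.2 hne)
  filter_upwards [Ioo_mem_nhdsGT hε, Ioo_mem_nhdsGT hpos] with τ hτ hτ' w hw1 hw2
  have hmem : (⟨w.re, v z⟩ : ℂ) ∈ ball (pairMap u v z) ε := by
    have : (⟨w.re, v z⟩ : ℂ) - pairMap u v z = ((w.re - u z : ℝ) : ℂ) := by
      apply Complex.ext <;> simp [pairMap]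
    rw [mem_ball_iff_norm, this, Complex.norm_real]
    exact hw1.trans hτ.2
  obtain ⟨x, hx, hFx⟩ := hεs hmem
  have hux : u x = w.re := congrArg Complex.re hFx
  have hvx : v x = v z := congrArg Complex.im hFx
  have hux0 : u x ≠ u 0 := by
    intro h0
    have : |w.re - u z| = |u z - u 0| := by rw [← hux, h0, abs_sub_comm]
    linarith [hτ'.2]
  have hxz : ‖x - z‖ < d / 100 := mem_ball_iff_norm.1 hx
  obtain ⟨σ, hσ, hσe⟩ : ∃ σ : ℝ, |σ| = 1 ∧ σ * |w.im - v z| = w.im - v z := by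
    rcases le_total 0 (w.im - v z) with h0 | h0
    · exact ⟨1, by simp, by rw [abs_of_nonneg h0, one_mul]⟩
    · exact ⟨-1, by simp, by rw [abs_of_nonpos h0]; ring⟩
  have hsub : closedBall x |w.im - v z| ⊆ ball z (3 / 10 * d) := by
    refine closedBall_subset_ball' ?_
    rw [dist_eq_norm]
    linarith
  obtain ⟨y, hy, hy1, hy2⟩ := h.exists_level_point (abs_nonneg (w.im - v z))
    (hsub.trans ((ball_subset_closedBall.trans (closedBall_subset_closedBall (by linarith))).trans
      hball)) hux0 hσ
  refine ⟨y, hsub hy, ?_, ?_⟩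
  · rintro rfl
    exact hux0 hy1.symm
  · apply Complex.ext
    · simp [pairMap, hy1, hux]
    · simp [pairMap, hy2, hvx, hσe]

theorem volume_le_lintegral_jacobian {E W : Set ℂ} (hE : MeasurableSet E)
    (hER : E ⊆ ball 0 R \ {0}) (hW : W ⊆ pairMap u v '' E) :
    volume W ≤ ∫⁻ z in E, ENNReal.ofReal
      |(gradientPairMap (V z) ((α ‖V z‖ / ‖V z‖ : ℝ) • (Complex.I * V z))).det| :=
  (measure_mono hW).trans <| addHaar_image_le_lintegral_abs_det_fderiv volume hE fun z hz =>
    ((h.u_deriv z (hER hz).1).pairMap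
      (h.v_deriv z (hER hz).1 (hER hz).2)).hasFDerivWithinAt

theorem not_pairMap_eq_of_ne {r : ℝ} (hrR : r ≤ R)
    (hv : ∀ a ∈ ball (0 : ℂ) r, ∀ b ∈ ball (0 : ℂ) r, |v a - v b| ≤ (1 + 1 / 10 ^ 8) * ‖a - b‖)
    {z₁ z₂ : ℂ} (hz₁ : ‖z₁‖ < r / 10000) (hz₂ : ‖z₂‖ < r / 10000) (h₁ : z₁ ≠ 0) (h₂ : z₂ ≠ 0)
    (hne : z₁ ≠ z₂) (hF : pairMap u v z₁ = pairMap u v z₂) (hu : u z₁ ≠ u 0) : False := by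
  set d := ‖z₁ - z₂‖ with hd_def
  have hd : 0 < d := norm_pos_iff.2 (sub_ne_zero.2 hne)
  have hdr : d < r / 5000 := by
    have := norm_sub_le z₁ z₂
    linarith
  have hu12 : u z₁ = u z₂ := congrArg Complex.re hF
  have hv12 : v z₁ = v z₂ := congrArg Complex.im hF
  have hL : closedBall z₁ (3000 * d) ⊆ ball 0 r := by
    refine closedBall_subset_ball' ?_
    rw [dist_zero_right]
    linarith
  have hrsub : ball (0 : ℂ) r ⊆ ball 0 R := ball_subset_ball hrR
  have hsmall : ∀ c ≤ 3000 * d, closedBall z₁ c ⊆ ball 0 r := fun c hc =>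
    (closedBall_subset_closedBall hc).trans hL
  obtain ⟨p, hp, -, hvp⟩ := h.exists_level_point (by positivity) (hL.trans hrsub) hu
    (σ := 1) (by simp)
  obtain ⟨m, hm, -, hvm⟩ := h.exists_level_point (by positivity) (hL.trans hrsub) hu
    (σ := -1) (by simp)
  obtain ⟨e, he, hstrip⟩ := exists_direction_of_almost_lipschitz hv hd
    (hL (mem_closedBall_self (by positivity))) (hL hp) (hL hm) (mem_closedBall_iff_norm.1 hp)
    (mem_closedBall_iff_norm.1 hm) (by linarith) (by linarith)
  have hT : volume {z ∈ closedBall z₁ (9 * d) | |v z - v z₁| ≤ 11 / 40 * d} ≤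
      ENNReal.ofReal (4 * (61 / 200 * d) * (9 * d)) := by
    refine le_trans (measure_mono fun z hz => ?_)
      (volume_strip_inter_closedBall_le he z₁ (a := 61 / 200 * d) (by positivity))
    exact ⟨hz.1, hstrip z (hsmall _ (by linarith) hz.1) (mem_closedBall_iff_norm.1 hz.1) hz.2⟩
  have hb₁ : closedBall z₁ d ⊆ ball 0 R := (hsmall _ (by linarith)).trans hrsub
  have hb₂ : closedBall z₂ d ⊆ ball 0 R := by
    refine (closedBall_subset_closedBall' (ε₂ := 2 * d) ?_).trans
      ((hsmall (2 * d) (by linarith)).trans hrsub)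
    rw [dist_eq_norm, norm_sub_rev]
    linarith
  obtain ⟨τ, ⟨hw₁, hw₂⟩, hτ : 0 < τ⟩ := (((h.eventually_window_subset_image h₁ hd hb₁ hu).and
    (h.eventually_window_subset_image h₂ hd hb₂ (hu12 ▸ hu))).and self_mem_nhdsWithin).exists
  set W : Set ℂ := {w | w.re ∈ Ioo (u z₁ - τ) (u z₁ + τ) ∧
    w.im ∈ Ioo (v z₁ - d / 4) (v z₁ + d / 4)} with hW
  have hWo : IsOpen W := (isOpen_Ioo.preimage Complex.continuous_re).inter
    (isOpen_Ioo.preimage Complex.continuous_im)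
  have hWm : ∀ w ∈ W, |w.re - u z₁| < τ ∧ |w.im - v z₁| < d / 4 := fun w hw =>
    ⟨abs_lt.2 ⟨by linarith [hw.1.1], by linarith [hw.1.2]⟩,
      abs_lt.2 ⟨by linarith [hw.2.1], by linarith [hw.2.2]⟩⟩
  have hWvol : volume W = ENNReal.ofReal (τ * d) := by
    rw [hW, volume_complex_box, Real.volume_Ioo, Real.volume_Ioo,
      ← ENNReal.ofReal_mul (by linarith)]
    congr 1
    ring
  set E : ℂ → Set ℂ := fun z => (ball z (3 / 10 * d) ∩ pairMap u v ⁻¹' W) \ {0} with hE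
  have hEo : ∀ z, closedBall z d ⊆ ball 0 R → IsOpen (E z) := fun z hz =>
    ((h.continuousOn_pairMap.mono ((ball_subset_closedBall.trans
      (closedBall_subset_closedBall (by linarith))).trans hz)).isOpen_inter_preimage isOpen_ball
        hWo).sdiff isClosed_singleton
  have hER : ∀ z, closedBall z d ⊆ ball 0 R → E z ⊆ ball 0 R \ {0} := fun z hz y hy =>
    ⟨hz (ball_subset_closedBall (ball_subset_ball (by linarith) hy.1.1)), hy.2⟩
  have hle₁ := h.volume_le_lintegral_jacobian (hEo z₁ hb₁).measurableSet (hER z₁ hb₁) (W := W) <| by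
    intro w hw
    obtain ⟨y, hy, hy0, rfl⟩ := hw₁ w (hWm w hw).1 (hWm w hw).2
    exact ⟨y, ⟨⟨hy, hw⟩, hy0⟩, rfl⟩
  have hle₂ := h.volume_le_lintegral_jacobian (hEo z₂ hb₂).measurableSet (hER z₂ hb₂) (W := W) <| by
    intro w hw
    obtain ⟨y, hy, hy0, rfl⟩ := hw₂ w (hu12 ▸ (hWm w hw).1) (hv12 ▸ (hWm w hw).2)
    exact ⟨y, ⟨⟨hy, hw⟩, hy0⟩, rfl⟩
  have hdisj : Disjoint (E z₁) (E z₂) := by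
    refine Disjoint.mono (fun y hy => hy.1.1) (fun y hy => hy.1.1) (ball_disjoint_ball ?_)
    rw [dist_eq_norm]
    linarith
  have hint := h.lintegral_jacobian_le hrR hv hd hτ (hsmall (10 * d) (by linarith))
    (E := E z₁ ∪ E z₂) ((hEo z₁ hb₁).measurableSet.union (hEo z₂ hb₂).measurableSet)
    (by
      rintro z (hz | hz)
      · exact (mem_ball.1 hz.1.1).le.trans (by linarith)
      · have := dist_triangle z z₂ z₁
        have h4 : dist z₂ z₁ = d := by rw [dist_comm, dist_eq_norm]
        have := mem_ball.1 hz.1.1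
        linarith)
    (by rintro z (hz | hz) <;> exact (hWm _ hz.1.2).1.le)
    (by rintro z (hz | hz) <;> exact (hWm _ hz.1.2).2.le)
  rw [lintegral_union (hEo z₂ hb₂).measurableSet hdisj] at hint
  have hfin := ((add_le_add hle₁ hle₂).trans hint).trans (mul_le_mul_right hT _)
  rw [hWvol, ← ENNReal.ofReal_add (by positivity) (by positivity),
    ← ENNReal.ofReal_mul (by positivity), ENNReal.ofReal_le_ofReal_iff (by positivity)] at hfin
  have hτd : 0 < τ * d := by positivity
  have heq : 11 / 10 * τ * (2 / (15 * d)) * (1 + 1 / 10 ^ 8) * (4 * (61 / 200 * d) * (9 * d)) =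
      (11 / 10 * (2 / 15) * (1 + 1 / 10 ^ 8) * (4 * (61 / 200) * 9)) * (τ * d) := by
    field_simp
  rw [heq] at hfin
  norm_num at hfin
  linarith

/-- Near the critical point `pairMap u v` is injective. -/
theorem exists_injOn : ∃ ρ > 0, ρ ≤ R ∧ InjOn (pairMap u v) (ball 0 ρ) := by
  obtain ⟨r, hr, hrR, hv⟩ := h.v_lip (1 / 10 ^ 8) (by positivity)
  have hρ : r / 10000 ≤ R := by linarith
  have hsub : ball (0 : ℂ) (r / 10000) ⊆ ball 0 R := ball_subset_ball hρ
  have hoff : ∀ z₁ ∈ ball (0 : ℂ) (r / 10000), ∀ z₂ ∈ ball (0 : ℂ) (r / 10000), z₁ ≠ 0 → z₂ ≠ 0 →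
      pairMap u v z₁ = pairMap u v z₂ → z₁ = z₂ := by
    intro z₁ hz₁ z₂ hz₂ h₁ h₂ hF
    by_contra hne
    obtain ⟨U₁, U₂, hU₁, hU₂, hzU₁, hzU₂, hdisj⟩ := t2_separation hne
    have hA : ∀ z ∈ ball (0 : ℂ) (r / 10000), z ≠ 0 → ∀ U, IsOpen U → z ∈ U →
        pairMap u v '' ((U ∩ ball 0 (r / 10000)) \ {0}) ∈ 𝓝 (pairMap u v z) := by
      intro z hz h0 U hU hzU
      rw [← h.map_nhds_eq (hsub hz) h0]
      exact image_mem_map (((hU.inter isOpen_ball).sdiff isClosed_singleton).mem_nhds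
        ⟨⟨hzU, hz⟩, h0⟩)
    have h1 := hA z₁ hz₁ h₁ U₁ hU₁ hzU₁
    have h2 := hA z₂ hz₂ h₂ U₂ hU₂ hzU₂
    rw [← hF] at h2
    obtain ⟨w, ⟨hw1, hw2⟩, hw3⟩ : ∃ w : ℂ, (w ∈ pairMap u v '' ((U₁ ∩ ball 0 (r / 10000)) \ {0}) ∧
        w ∈ pairMap u v '' ((U₂ ∩ ball 0 (r / 10000)) \ {0})) ∧ w.re ≠ u 0 := by
      have hc : Tendsto (fun t : ℝ => pairMap u v z₁ + (t : ℂ)) (𝓝[≠] 0) (𝓝 (pairMap u v z₁)) := by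
        have : Continuous fun t : ℝ => pairMap u v z₁ + (t : ℂ) := by fun_prop
        simpa using (this.tendsto 0).mono_left nhdsWithin_le_nhds
      have hfin : ∀ᶠ t : ℝ in 𝓝[≠] 0, u z₁ + t ≠ u 0 := by
        by_cases hc0 : u z₁ = u 0
        · filter_upwards [self_mem_nhdsWithin] with t ht
          simpa [hc0] using ht
        · have : Tendsto (fun t : ℝ => u z₁ + t) (𝓝 0) (𝓝 (u z₁)) := by
            have : Continuous fun t : ℝ => u z₁ + t := by fun_prop
            simpa using this.tendsto 0
          exact (this.eventually_ne hc0).filter_mono nhdsWithin_le_nhds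
      obtain ⟨t, ht1, ht2⟩ := ((hc.eventually (inter_mem h1 h2)).and hfin).exists
      exact ⟨_, ht1, by simpa [pairMap] using ht2⟩
    obtain ⟨y₁, hy₁, rfl⟩ := hw1
    obtain ⟨y₂, hy₂, hy⟩ := hw2
    exact h.not_pairMap_eq_of_ne hrR hv (mem_ball_zero_iff.1 hy₁.1.2)
      (mem_ball_zero_iff.1 hy₂.1.2) hy₁.2 hy₂.2
      (fun heq => hdisj.ne_of_mem hy₁.1.1 hy₂.1.1 heq) hy.symm hw3
  have hzero : ∀ z ∈ ball (0 : ℂ) (r / 10000), z ≠ 0 → pairMap u v z ≠ pairMap u v 0 := by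
    intro z hz h0 hF
    have h00 : (0 : ℂ) ∈ ball (0 : ℂ) (r / 10000) := mem_ball_self (by positivity)
    obtain ⟨U₁, U₂, hU₁, hU₂, hzU₁, hzU₂, hdisj⟩ := t2_separation h0
    have h1 : pairMap u v '' (U₁ ∩ ball 0 (r / 10000)) ∈ 𝓝 (pairMap u v 0) := by
      rw [← hF, ← h.map_nhds_eq (hsub hz) h0]
      exact image_mem_map ((hU₁.inter isOpen_ball).mem_nhds ⟨hzU₁, hz⟩)
    have h2 : ∀ᶠ y in 𝓝 (0 : ℂ), pairMap u v y ∈ pairMap u v '' (U₁ ∩ ball 0 (r / 10000)) :=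
      (h.continuousOn_pairMap.continuousAt (isOpen_ball.mem_nhds (hsub h00))).eventually h1
    have h3 : ∀ᶠ y in 𝓝[≠] (0 : ℂ), y ∈ U₂ ∩ ball 0 (r / 10000) :=
      mem_nhdsWithin_of_mem_nhds ((hU₂.inter isOpen_ball).mem_nhds ⟨hzU₂, h00⟩)
    obtain ⟨y, ⟨⟨x, hx, hxy⟩, hy⟩, hy0 : y ≠ 0⟩ :=
      (((h2.filter_mono nhdsWithin_le_nhds).and h3).and self_mem_nhdsWithin).exists
    by_cases hx0 : x = 0
    · exact hdisj.ne_of_mem hx.1 hzU₂ hx0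
    · exact hdisj.ne_of_mem hx.1 hy.1 (hoff x hx.2 y hy.2 hx0 hy0 hxy)
  refine ⟨r / 10000, by positivity, hρ, fun z₁ hz₁ z₂ hz₂ hF => ?_⟩
  by_cases h₁ : z₁ = 0
  · by_contra hne
    subst h₁
    exact hzero z₂ hz₂ (Ne.symm hne) hF.symm
  · by_cases h₂ : z₂ = 0
    · subst h₂
      exact absurd hF (hzero z₁ hz₁ h₁)
    · exact hoff z₁ hz₁ z₂ hz₂ h₁ h₂ hF

end ConjugatePair

theorem isPreconnected_ball_diff_center (c : ℂ) (ε : ℝ) : IsPreconnected (ball c ε \ {c}) := by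
  have h1 : IsPreconnected (Ioo 0 ε ×ˢ (univ : Set ℝ)) :=
    isPreconnected_Ioo.prod isPreconnected_univ
  convert h1.image (fun x : ℝ × ℝ => c + x.1 * Complex.exp (x.2 * Complex.I))
    (by fun_prop) using 1
  ext z
  simp only [Set.mem_sdiff, mem_ball_iff_norm, mem_singleton_iff, mem_image, mem_prod, mem_Ioo,
    mem_univ, and_true, Prod.exists]
  constructor
  · rintro ⟨h2, h3⟩
    exact ⟨‖z - c‖, Complex.arg (z - c), ⟨norm_pos_iff.2 (sub_ne_zero.2 h3), h2⟩, by
      rw [Complex.norm_mul_exp_arg_mul_I]; ring⟩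
  · rintro ⟨r, θ, ⟨h2, h3⟩, rfl⟩
    refine ⟨?_, ?_⟩
    · rw [add_sub_cancel_left, norm_mul, Complex.norm_exp_ofReal_mul_I, mul_one, Complex.norm_real,
        Real.norm_of_nonneg h2.le]
      exact h3
    · simp [h2.ne']

/-- Strict monotonicity of the pair of maps `m ↦ x m`, `m ↦ y m` on unit vectors `m`, where
`x` and `y` are monotonically related. -/
theorem unit_vector_monotone {a b a' b' x y x' y' : ℝ} (h : a ^ 2 + b ^ 2 = 1)
    (h' : a' ^ 2 + b' ^ 2 = 1) (hx : 0 < x) (hy : 0 < y) (hx' : 0 < x') (hy' : 0 < y')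
    (hxy : 0 ≤ (x' - x) * (y' - y)) (hxy0 : (x' - x) * (y' - y) = 0 → x' = x ∧ y' = y) :
    0 ≤ (a' * x' - a * x) * (a' * y' - a * y) + (b' * y' - b * y) * (b' * x' - b * x) ∧
    ((a' * x' - a * x) * (a' * y' - a * y) + (b' * y' - b * y) * (b' * x' - b * x) = 0 →
      a' * x' - a * x = 0 ∧ b' * y' - b * y = 0) := by
  have hc : a * a' + b * b' = 1 - ((a' - a) ^ 2 + (b' - b) ^ 2) / 2 := by
    linear_combination 1 / 2 * h + 1 / 2 * h'
  have key : (a' * x' - a * x) * (a' * y' - a * y) + (b' * y' - b * y) * (b' * x' - b * x) =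
      (x' - x) * (y' - y) + ((a' - a) ^ 2 + (b' - b) ^ 2) / 2 * (x' * y + x * y') := by
    linear_combination (x' * y') * h' + x * y * h - (x' * y + x * y') * hc
  have hP : 0 < x' * y + x * y' := by positivity
  have h2 : 0 ≤ ((a' - a) ^ 2 + (b' - b) ^ 2) / 2 * (x' * y + x * y') := by positivity
  rw [key]
  refine ⟨by linarith, fun h0 => ?_⟩
  obtain ⟨rfl, rfl⟩ := hxy0 (by linarith)
  have h3 : (a' - a) ^ 2 + (b' - b) ^ 2 = 0 := by
    have h4 : ((a' - a) ^ 2 + (b' - b) ^ 2) / 2 * (x' * y' + x' * y') = 0 := by linarith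
    rcases mul_eq_zero.1 h4 with h5 | h5
    · linarith
    · exact absurd h5 hP.ne'
  have ha : a' - a = 0 := by nlinarith [sq_nonneg (a' - a), sq_nonneg (b' - b)]
  have hb : b' - b = 0 := by nlinarith [sq_nonneg (a' - a), sq_nonneg (b' - b)]
  exact ⟨by linear_combination x' * ha, by linear_combination y' * hb⟩

namespace ConjugatePair

variable {R : ℝ} {α : ℝ → ℝ} {u v : ℂ → ℝ} {V : ℂ → ℂ} (h : ConjugatePair R α u v V)
include h

/-- `pairMap u v` has a continuous local inverse at the critical point. -/
theorem exists_continuous_inverse : ∃ ε > 0, ∃ g : ℂ → ℂ, g (pairMap u v 0) = 0 ∧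
    ∀ w ∈ ball (pairMap u v 0) ε, g w ∈ ball (0 : ℂ) R ∧ pairMap u v (g w) = w ∧
      ContinuousAt g w := by
  obtain ⟨ρ, hρ, hρR, hinj⟩ := h.exists_injOn
  have hsub : ball (0 : ℂ) ρ ⊆ ball 0 R := ball_subset_ball hρR
  have h00 : (0 : ℂ) ∈ ball (0 : ℂ) ρ := mem_ball_self hρ
  have hoff : ∀ z ∈ ball (0 : ℂ) ρ, z ≠ 0 → pairMap u v z ≠ pairMap u v 0 := fun z hz h0 heq =>
    h0 (hinj hz h00 heq)
  have hopen0 : ∀ r, 0 < r → r < ρ → pairMap u v '' ball 0 r ∈ 𝓝 (pairMap u v 0) := by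
    intro r hr hrρ
    have hcs : IsClosed (pairMap u v '' sphere 0 r) :=
      ((isCompact_sphere (0 : ℂ) r).image_of_continuousOn (h.continuousOn_pairMap.mono
        ((sphere_subset_ball hrρ).trans hsub))).isClosed
    have hcb : IsClosed (pairMap u v '' closedBall 0 r) :=
      ((isCompact_closedBall (0 : ℂ) r).image_of_continuousOn (h.continuousOn_pairMap.mono
        ((closedBall_subset_ball hrρ).trans hsub))).isClosed
    have hns : (pairMap u v '' sphere 0 r)ᶜ ∈ 𝓝 (pairMap u v 0) := by
      refine hcs.isOpen_compl.mem_nhds ?_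
      rintro ⟨z, hz, hz'⟩
      exact hoff z (sphere_subset_ball hrρ hz) (ne_of_mem_sphere hz hr.ne') hz'
    obtain ⟨ε, hε, hεs⟩ := Metric.mem_nhds_iff.1 hns
    set A := pairMap u v '' (ball 0 r \ {0}) with hA
    have hAo : IsOpen A := by
      rw [isOpen_iff_mem_nhds]
      rintro _ ⟨z, hz, rfl⟩
      rw [← h.map_nhds_eq (hsub (ball_subset_ball hrρ.le hz.1)) hz.2]
      exact image_mem_map ((isOpen_ball.sdiff isClosed_singleton).mem_nhds hz)
    have hcov : ball (pairMap u v 0) ε \ {pairMap u v 0} ⊆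
        A ∪ (pairMap u v '' closedBall 0 r)ᶜ := by
      intro w hw
      by_cases hw' : w ∈ pairMap u v '' closedBall 0 r
      · obtain ⟨z, hz, rfl⟩ := hw'
        left
        refine ⟨z, ⟨?_, ?_⟩, rfl⟩
        · rw [mem_closedBall] at hz
          refine lt_of_le_of_ne hz fun heq => hεs hw.1 ⟨z, heq, rfl⟩
        · rintro rfl
          exact hw.2 rfl
      · exact Or.inr hw'
    have hdisj : Disjoint A (pairMap u v '' closedBall 0 r)ᶜ :=
      disjoint_compl_right.mono_left (image_mono (sdiff_subset.trans ball_subset_closedBall))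
    have hne : (ball (pairMap u v 0) ε \ {pairMap u v 0} ∩ A).Nonempty := by
      have h1 : ∀ᶠ y in 𝓝 (0 : ℂ), pairMap u v y ∈ ball (pairMap u v 0) ε :=
        (h.continuousOn_pairMap.continuousAt (isOpen_ball.mem_nhds (hsub h00))).eventually
          (ball_mem_nhds _ hε)
      have h2 : ∀ᶠ y in 𝓝 (0 : ℂ), y ∈ ball (0 : ℂ) r := ball_mem_nhds _ hr
      obtain ⟨y, ⟨hy1, hy2⟩, hy0 : y ≠ 0⟩ := (((h1.and h2).filter_mono
        (nhdsWithin_le_nhds (s := {0}ᶜ))).and self_mem_nhdsWithin).exists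
      exact ⟨_, ⟨hy1, hoff y (ball_subset_ball hrρ.le hy2) hy0⟩, y, ⟨hy2, hy0⟩, rfl⟩
    have hsubA := (isPreconnected_ball_diff_center (pairMap u v 0) ε).subset_left_of_subset_union
      hAo hcb.isOpen_compl hdisj hcov hne
    filter_upwards [ball_mem_nhds (pairMap u v 0) hε] with w hw
    by_cases hw0 : w = pairMap u v 0
    · exact ⟨0, mem_ball_self hr, hw0.symm⟩
    · obtain ⟨z, hz, rfl⟩ := hsubA ⟨hw, hw0⟩
      exact ⟨z, hz.1, rfl⟩
  have hopen : ∀ z ∈ ball (0 : ℂ) ρ, 𝓝 (pairMap u v z) ≤ map (pairMap u v) (𝓝 z) := by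
    intro z hz
    by_cases h0 : z = 0
    · subst h0
      intro s hs
      obtain ⟨δ, hδ, hδs⟩ := Metric.mem_nhds_iff.1 (mem_map.1 hs)
      refine mem_of_superset (hopen0 (min δ (ρ / 2)) (by positivity)
        (lt_of_le_of_lt (min_le_right _ _) (by linarith))) ?_
      rintro _ ⟨y, hy, rfl⟩
      exact hδs (ball_subset_ball (min_le_left _ _) hy)
    · exact (h.map_nhds_eq (hsub hz) h0).ge
  obtain ⟨ε, hε, hεs⟩ := Metric.mem_nhds_iff.1 (hopen0 (ρ / 2) (by positivity) (by linarith))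
  have hsub2 : ball (0 : ℂ) (ρ / 2) ⊆ ball 0 ρ := ball_subset_ball (by linarith)
  have hex : ∀ w ∈ ball (pairMap u v 0) ε, ∃ z ∈ ball (0 : ℂ) ρ, pairMap u v z = w := fun w hw => by
    obtain ⟨z, hz, rfl⟩ := hεs hw
    exact ⟨z, hsub2 hz, rfl⟩
  refine ⟨ε, hε, Function.invFunOn (pairMap u v) (ball 0 ρ),
    hinj.leftInvOn_invFunOn h00, fun w hw => ?_⟩
  have hgw := Function.invFunOn_mem (hex w hw)
  have hFgw := Function.invFunOn_eq (hex w hw)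
  refine ⟨hsub hgw, hFgw, ?_⟩
  set z := Function.invFunOn (pairMap u v) (ball 0 ρ) w with hz
  rw [ContinuousAt, ← hz, ← hFgw]
  refine (tendsto_map'_iff.2 ?_).mono_left (hopen z hgw)
  refine tendsto_id.congr' ?_
  filter_upwards [isOpen_ball.mem_nhds hgw] with y hy
  exact (hinj.leftInvOn_invFunOn hy).symm

end ConjugatePair

/-- The gradient of the component along `e` of the inverse of the map with derivative
`gradientPairMap V ((a / ‖V‖) • I V)`. -/
def inverseGradient (a : ℝ) (V e : ℂ) : ℂ := ⟨⟪e, V⟫ / ‖V‖ ^ 2, ⟪e, Complex.I * V⟫ / (a * ‖V‖)⟩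

theorem inner_symm_eq_inverseGradient {a : ℝ} {V : ℂ} (ha : a ≠ 0) (hV : V ≠ 0) {E : ℂ ≃L[ℝ] ℂ}
    (hE : (E : ℂ →L[ℝ] ℂ) = gradientPairMap V ((a / ‖V‖ : ℝ) • (Complex.I * V))) (e w : ℂ) :
    ⟪e, E.symm w⟫ = ⟪inverseGradient a V e, w⟫ := by
  have hq : ‖V‖ ≠ 0 := norm_ne_zero_iff.2 hV
  have h2 : ‖V‖ ^ 2 = V.re * V.re + V.im * V.im := by
    rw [sq, Complex.norm_mul_self_eq_normSq, Complex.normSq_apply]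
  set y : ℂ := (w.re / ‖V‖ ^ 2 : ℝ) • V + (w.im / (a * ‖V‖) : ℝ) • (Complex.I * V) with hy
  have hEy : E y = w := by
    change (E : ℂ →L[ℝ] ℂ) y = w
    rw [hE, gradientPairMap_apply]
    apply Complex.ext
    · simp only [hy, Complex.inner, Complex.real_smul, Complex.mul_re, Complex.mul_im,
        Complex.add_re, Complex.add_im, Complex.ofReal_re, Complex.ofReal_im,
        Complex.I_re, Complex.I_im, Complex.conj_re, Complex.conj_im]
      field_simp
      linear_combination (-a * w.re) * h2
    · simp only [hy, Complex.inner, Complex.real_smul, Complex.mul_re, Complex.mul_im,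
        Complex.add_re, Complex.add_im, Complex.ofReal_re, Complex.ofReal_im,
        Complex.I_re, Complex.I_im, Complex.conj_re, Complex.conj_im]
      field_simp
      linear_combination (-(a * ‖V‖ * w.im)) * h2
  have : E.symm w = y := by rw [← hEy, E.symm_apply_apply]
  rw [this, hy, inner_add_right, inner_smul_right, inner_smul_right,
    Complex.inner (inverseGradient a V e)]
  simp only [inverseGradient, Complex.mul_re, Complex.conj_re, Complex.conj_im]
  ring

theorem Complex.inner_sq_add_inner_I_mul_sq (e V : ℂ) :
    ⟪e, V⟫ ^ 2 + ⟪e, Complex.I * V⟫ ^ 2 = ‖e‖ ^ 2 * ‖V‖ ^ 2 := by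
  simp only [Complex.inner, Complex.sq_norm, Complex.normSq_apply, Complex.mul_re, Complex.mul_im,
    Complex.I_re, Complex.I_im, Complex.conj_re, Complex.conj_im]
  ring

theorem norm_inverseGradient_le {a : ℝ} {V e : ℂ} (ha : 1 ≤ a) (he : ‖e‖ = 1) :
    ‖inverseGradient a V e‖ ≤ 1 / ‖V‖ + 1 := by
  rcases eq_or_ne V 0 with rfl | hV
  · simp only [inverseGradient, inner_zero_right, mul_zero, zero_div, norm_zero, div_zero]
    exact (norm_zero (E := ℂ)).le.trans (by norm_num)
  have hq : 0 < ‖V‖ := norm_pos_iff.2 hV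
  refine (Complex.norm_le_abs_re_add_abs_im _).trans ?_
  have h1 : |⟪e, V⟫| ≤ ‖V‖ := by simpa [he] using abs_real_inner_le_norm e V
  have h2 : |⟪e, Complex.I * V⟫| ≤ ‖V‖ := by
    simpa [he] using abs_real_inner_le_norm e (Complex.I * V)
  simp only [inverseGradient, abs_div, abs_mul, abs_of_pos (pow_pos hq 2), abs_of_pos hq,
    abs_of_pos (lt_of_lt_of_le one_pos ha)]
  have h3 : |⟪e, V⟫| / ‖V‖ ^ 2 ≤ 1 / ‖V‖ := by
    rw [div_le_div_iff₀ (by positivity) hq]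
    nlinarith
  have h4 : |⟪e, Complex.I * V⟫| / (a * ‖V‖) ≤ 1 := by
    rw [div_le_one (by positivity)]
    nlinarith
  exact add_le_add h3 h4

namespace ConjugatePair

variable {R : ℝ} {α : ℝ → ℝ} {u v : ℂ → ℝ} {V : ℂ → ℂ} (h : ConjugatePair R α u v V)
include h

theorem inverseGradient_monotone {z z' e : ℂ} (he : ‖e‖ = 1) (hz : V z ≠ 0) (hz' : V z' ≠ 0) :
    let p := inverseGradient (α ‖V z'‖) (V z') e - inverseGradient (α ‖V z‖) (V z) e
    let r := inverseGradient (α ‖V z'‖) (V z') (Complex.I * e) -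
      inverseGradient (α ‖V z‖) (V z) (Complex.I * e)
    0 ≤ p.re * r.im - p.im * r.re ∧ (p.re * r.im - p.im * r.re = 0 → p = 0) := by
  have hq : 0 < ‖V z‖ := norm_pos_iff.2 hz
  have hq' : 0 < ‖V z'‖ := norm_pos_iff.2 hz'
  have hα : 0 < α ‖V z‖ := one_pos.trans (h.one_lt_α hq)
  have hα' : 0 < α ‖V z'‖ := one_pos.trans (h.one_lt_α hq')
  have hrot1 : ∀ W : ℂ, ⟪Complex.I * e, W⟫ = -⟪e, Complex.I * W⟫ := fun W => by
    simp only [Complex.inner, Complex.mul_re, Complex.mul_im, Complex.I_re, Complex.I_im,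
      Complex.conj_re, Complex.conj_im]
    ring
  have hrot2 : ∀ W : ℂ, ⟪Complex.I * e, Complex.I * W⟫ = ⟪e, W⟫ := fun W => by
    simp only [Complex.inner, Complex.mul_re, Complex.mul_im, Complex.I_re, Complex.I_im,
      Complex.conj_re, Complex.conj_im]
    ring
  have hunit : ∀ W : ℂ, 0 < ‖W‖ → (⟪e, W⟫ / ‖W‖) ^ 2 + (⟪e, Complex.I * W⟫ / ‖W‖) ^ 2 = 1 := by
    intro W hW
    rw [div_pow, div_pow, ← add_div, Complex.inner_sq_add_inner_I_mul_sq, he, one_pow, one_mul,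
      div_self (by positivity)]
  have key := unit_vector_monotone (hunit _ hq) (hunit _ hq') (inv_pos.2 hq) (inv_pos.2 hα)
    (inv_pos.2 hq') (inv_pos.2 hα')
  have hlt : ∀ {a b : ℝ}, 0 < a → 0 < b → a < b → 0 < (a⁻¹ - b⁻¹) * ((α a)⁻¹ - (α b)⁻¹) := by
    intro a b ha hb hab
    refine mul_pos (sub_pos.2 (inv_strictAnti₀ ha hab)) (sub_pos.2 (inv_strictAnti₀ ?_ ?_))
    · exact one_pos.trans (h.one_lt_α ha)
    · exact h.α_mono ha.le hb.le hab
  have hcase : ‖V z'‖ = ‖V z‖ ∨ 0 < (‖V z'‖⁻¹ - ‖V z‖⁻¹) * ((α ‖V z'‖)⁻¹ - (α ‖V z‖)⁻¹) := by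
    rcases lt_trichotomy ‖V z'‖ ‖V z‖ with hl | hl | hl
    · exact Or.inr (hlt hq' hq hl)
    · exact Or.inl hl
    · refine Or.inr ?_
      have := hlt hq hq' hl
      linarith
  have key2 := key (by rcases hcase with h1 | h1 <;> simp [*, h1.le])
    (by
      rcases hcase with h1 | h1
      · simp [h1]
      · exact fun h0 => absurd h0 h1.ne')
  intro p r
  have hpre : p.re = ⟪e, V z'⟫ / ‖V z'‖ * ‖V z'‖⁻¹ - ⟪e, V z⟫ / ‖V z‖ * ‖V z‖⁻¹ := by
    simp only [p, inverseGradient, Complex.sub_re]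
    field_simp
  have hpim : p.im = ⟪e, Complex.I * V z'⟫ / ‖V z'‖ * (α ‖V z'‖)⁻¹ -
      ⟪e, Complex.I * V z⟫ / ‖V z‖ * (α ‖V z‖)⁻¹ := by
    simp only [p, inverseGradient, Complex.sub_im]
    field_simp
  have hrre : r.re = -(⟪e, Complex.I * V z'⟫ / ‖V z'‖ * ‖V z'‖⁻¹ -
      ⟪e, Complex.I * V z⟫ / ‖V z‖ * ‖V z‖⁻¹) := by
    simp only [r, inverseGradient, Complex.sub_re, hrot1]
    field_simp
    ring
  have hrim : r.im = ⟪e, V z'⟫ / ‖V z'‖ * (α ‖V z'‖)⁻¹ - ⟪e, V z⟫ / ‖V z‖ * (α ‖V z‖)⁻¹ := by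
    simp only [r, inverseGradient, Complex.sub_im, hrot2]
    field_simp
  rw [← hpre, ← hpim, ← hrim, ← neg_eq_iff_eq_neg.2 hrre, mul_neg, ← sub_eq_add_neg] at key2
  exact ⟨key2.1, fun h0 => Complex.ext (key2.2 h0).1 (key2.2 h0).2⟩

theorem continuousOn_inverseGradient (e : ℂ) :
    ContinuousOn (fun z => inverseGradient (α ‖V z‖) (V z) e) (ball 0 R \ {0}) := by
  have hV := h.V_cont.mono (sdiff_subset (t := {(0 : ℂ)}))
  have hα : ContinuousOn (fun z => α ‖V z‖) (ball 0 R \ {0}) :=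
    h.α_cont.comp hV.norm fun z _ => norm_nonneg _
  have hne : ∀ z ∈ ball (0 : ℂ) R \ {0}, ‖V z‖ ≠ 0 := fun z hz =>
    norm_ne_zero_iff.2 (h.V_ne z hz.1 hz.2)
  refine Complex.equivRealProdCLM.symm.continuous.comp_continuousOn
    (ContinuousOn.prodMk (ContinuousOn.div ?_ (hV.norm.pow 2) fun z hz => pow_ne_zero 2 (hne z hz))
      (ContinuousOn.div ?_ (hα.mul hV.norm) fun z hz => mul_ne_zero ?_ (hne z hz)))
  · exact continuousOn_const.inner hV
  · exact continuousOn_const.inner (continuousOn_const.mul hV)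
  · exact (one_pos.trans_le (h.one_le_α (norm_nonneg _))).ne'

theorem false : False := by
  obtain ⟨ε, hε, g, hg0, hg⟩ := h.exists_continuous_inverse
  set o := pairMap u v 0 with ho
  have hoε : o ∈ ball o ε := mem_ball_self hε
  have hgR : ∀ w ∈ ball o ε, g w ∈ ball (0 : ℂ) R := fun w hw => (hg w hw).1
  have hgne : ∀ w ∈ ball o ε, w ≠ o → g w ≠ 0 := fun w hw hwo h0 =>
    hwo (by rw [← (hg w hw).2.1, h0])
  have hVne : ∀ w ∈ ball o ε, w ≠ o → V (g w) ≠ 0 := fun w hw hwo =>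
    h.V_ne _ (hgR w hw) (hgne w hw hwo)
  have hgc : ContinuousOn g (ball o ε) := fun w hw => (hg w hw).2.2.continuousWithinAt
  set P : ℂ → ℂ → ℂ := fun e w => inverseGradient (α ‖V (g w)‖) (V (g w)) e with hP
  have hPd : ∀ e, ∀ w ∈ ball o ε, w ≠ o → HasFDerivAt (fun w => ⟪e, g w⟫)
      (innerSL ℝ (P e w)) w := by
    intro e w hw hwo
    obtain ⟨E, hE⟩ := h.exists_equiv (hgR w hw) (hgne w hw hwo)
    have hd := (h.hasStrictFDerivAt (hgR w hw) (hgne w hw hwo)).hasFDerivAt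
    rw [← hE] at hd
    have hgd := hd.of_local_left_inverse (hg w hw).2.2 (by
      filter_upwards [isOpen_ball.mem_nhds hw] with y hy using (hg y hy).2.1)
    have := ((innerSL ℝ e).hasFDerivAt (x := g w)).comp w hgd
    refine this.congr_fderiv ?_
    ext1 x
    exact inner_symm_eq_inverseGradient
      (one_pos.trans_le (h.one_le_α (norm_nonneg _))).ne' (hVne w hw hwo) hE e x
  have hPc : ∀ e, ContinuousOn (P e) (ball o ε \ {o}) := fun e =>
    (h.continuousOn_inverseGradient e).comp (hgc.mono sdiff_subset)
      fun w hw => ⟨hgR w hw.1, hgne w hw.1 hw.2⟩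
  -- a Lipschitz bound for the inverse on an annulus
  obtain ⟨C, hC, hCb⟩ : ∃ C > 0, ∀ w, ε / 4 ≤ ‖w - o‖ → ‖w - o‖ ≤ 3 / 4 * ε →
      1 / ‖V (g w)‖ + 1 ≤ C := by
    have hn : Continuous fun w : ℂ => ‖w - o‖ := by fun_prop
    have hK : IsCompact {w : ℂ | ε / 4 ≤ ‖w - o‖ ∧ ‖w - o‖ ≤ 3 / 4 * ε} := by
      refine (isCompact_closedBall o (3 / 4 * ε)).of_isClosed_subset ?_ fun w hw =>
        mem_closedBall_iff_norm.2 hw.2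
      exact (isClosed_le continuous_const hn).inter (isClosed_le hn continuous_const)
    have hKs : ∀ w ∈ {w : ℂ | ε / 4 ≤ ‖w - o‖ ∧ ‖w - o‖ ≤ 3 / 4 * ε}, w ∈ ball o ε ∧ w ≠ o := by
      rintro w ⟨hw1, hw2⟩
      refine ⟨mem_ball_iff_norm.2 (by linarith), ?_⟩
      rintro rfl
      simp at hw1
      linarith
    have hc : ContinuousOn (fun w => 1 / ‖V (g w)‖ + 1)
        {w : ℂ | ε / 4 ≤ ‖w - o‖ ∧ ‖w - o‖ ≤ 3 / 4 * ε} :=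
      (continuousOn_const.div ((h.V_cont.comp hgc hgR).norm.mono fun w hw => (hKs w hw).1)
        fun w hw => norm_ne_zero_iff.2 (hVne w (hKs w hw).1 (hKs w hw).2)).add continuousOn_const
    obtain ⟨C, hC⟩ := hK.bddAbove_image hc
    exact ⟨max C 1, by positivity, fun w h1 h2 => (hC ⟨w, ⟨h1, h2⟩, rfl⟩).trans (le_max_left _ _)⟩
  have hlip : ∀ e : ℂ, ‖e‖ = 1 → ∀ w ∈ sphere o (ε / 2), ∀ k : ℂ, ‖k‖ < ε / 4 →
      ⟪e, g (w + k)⟫ - ⟪e, g w⟫ ≤ C * ‖k‖ := by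
    intro e he w hw k hk
    rw [mem_sphere_iff_norm] at hw
    have hball : ∀ y ∈ ball w (ε / 4), ε / 4 ≤ ‖y - o‖ ∧ ‖y - o‖ ≤ 3 / 4 * ε := by
      intro y hy
      rw [mem_ball_iff_norm] at hy
      have h1 := norm_sub_le_norm_sub_add_norm_sub y w o
      have h2 := norm_sub_le_norm_sub_add_norm_sub w y o
      rw [norm_sub_rev w y] at h2
      constructor <;> linarith
    have hsub : ∀ y ∈ ball w (ε / 4), y ∈ ball o ε ∧ y ≠ o := by
      intro y hy
      refine ⟨mem_ball_iff_norm.2 (by linarith [(hball y hy).2]), ?_⟩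
      rintro rfl
      have := (hball o hy).1
      simp at this
      linarith
    have hmv := (convex_ball w (ε / 4)).norm_image_sub_le_of_norm_hasFDerivWithin_le
      (f := fun w => ⟪e, g w⟫) (f' := fun y => innerSL ℝ (P e y)) (C := C)
      (fun y hy => (hPd e y (hsub y hy).1 (hsub y hy).2).hasFDerivWithinAt)
      (fun y hy => by
        rw [innerSL_apply_norm]
        exact (norm_inverseGradient_le (h.one_le_α (norm_nonneg _)) he).trans
          (hCb y (hball y hy).1 (hball y hy).2))
      (mem_ball_self (by positivity)) (y := w + k) (by simpa [mem_ball_iff_norm] using hk)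
    rw [add_sub_cancel_left] at hmv
    exact (le_abs_self _).trans hmv
  -- the maximum principle transfers the Lipschitz bound to the center
  have hcenter : ∀ k : ℂ, ‖k‖ < ε / 4 → ‖g (o + k)‖ ≤ C * ‖k‖ := by
    intro k hk
    by_cases hg1 : g (o + k) = 0
    · rw [hg1, norm_zero]; positivity
    have hn : ‖g (o + k)‖ ≠ 0 := norm_ne_zero_iff.2 hg1
    set e : ℂ := (‖g (o + k)‖⁻¹ : ℝ) • g (o + k) with he_def
    have he : ‖e‖ = 1 := by
      rw [he_def, norm_smul, norm_inv, norm_norm, inv_mul_cancel₀ hn]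
    have hmem : ∀ w ∈ closedBall o (ε / 2), w ∈ ball o ε ∧ w + k ∈ ball o ε := by
      intro w hw
      rw [mem_closedBall_iff_norm] at hw
      rw [mem_ball_iff_norm, mem_ball_iff_norm]
      refine ⟨by linarith, ?_⟩
      have : w + k - o = w - o + k := by ring
      rw [this]
      linarith [norm_add_le (w - o) k]
    have hmemS : ∀ w ∈ ball o (ε / 2) \ {o, o - k}, (w ∈ ball o ε ∧ w ≠ o) ∧
        (w + k ∈ ball o ε ∧ w + k ≠ o) := by
      rintro w ⟨hw, hwS⟩
      simp only [mem_insert_iff, mem_singleton_iff, not_or] at hwS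
      obtain ⟨h1, h2⟩ := hmem w (ball_subset_closedBall hw)
      exact ⟨⟨h1, hwS.1⟩, h2, fun h3 => hwS.2 (eq_sub_of_add_eq h3)⟩
    have hadd : Continuous fun w : ℂ => w + k := by fun_prop
    have hdiffc : ∀ e : ℂ, ContinuousOn (fun w => ⟪e, g (w + k)⟫ - ⟪e, g w⟫)
        (closedBall o (ε / 2)) := fun e =>
      (continuousOn_const.inner (hgc.comp hadd.continuousOn fun w hw => (hmem w hw).2)).sub
        (continuousOn_const.inner (hgc.mono fun w hw => (hmem w hw).1))
    have hdiffd : ∀ e : ℂ, ∀ w ∈ ball o (ε / 2) \ {o, o - k},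
        HasFDerivAt (fun w => ⟪e, g (w + k)⟫ - ⟪e, g w⟫)
          (innerSL ℝ (P e (w + k) - P e w)) w := by
      intro e w hw
      obtain ⟨⟨h1, h2⟩, h3, h4⟩ := hmemS w hw
      rw [map_sub]
      have h5 : HasFDerivAt (fun w : ℂ => w + k) (ContinuousLinearMap.id ℝ ℂ) w :=
        (hasFDerivAt_id w).add_const k
      exact ((hPd e (w + k) h3 h4).comp w h5).sub (hPd e w h1 h2)
    have hdiffp : ∀ e : ℂ, ContinuousOn (fun w => P e (w + k) - P e w)
        (ball o (ε / 2) \ {o, o - k}) := fun e =>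
      ((hPc e).comp hadd.continuousOn fun w hw => (hmemS w hw).2).sub
        ((hPc e).mono fun w hw => (hmemS w hw).1)
    have hmono : ∀ w ∈ ball o (ε / 2) \ {o, o - k}, _ := fun w hw =>
      h.inverseGradient_monotone he (hVne w (hmemS w hw).1.1 (hmemS w hw).1.2)
        (hVne _ (hmemS w hw).2.1 (hmemS w hw).2.2)
    have hmax := le_of_le_sphere_of_jacobian_nonneg (Set.toFinite {o, o - k})
      (hdiffc e) (hdiffc (Complex.I * e)) (hdiffd e) (hdiffd (Complex.I * e)) (hdiffp e)
      (hdiffp (Complex.I * e)) (fun w hw => (hmono w hw).1) (fun w hw => (hmono w hw).2)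
      (m := C * ‖k‖) (fun w hw => hlip e he w hw k hk) o (mem_closedBall_self (by positivity))
    rw [hg0, inner_zero_right, sub_zero, he_def, real_inner_smul_left,
      real_inner_self_eq_norm_sq] at hmax
    calc ‖g (o + k)‖ = ‖g (o + k)‖⁻¹ * ‖g (o + k)‖ ^ 2 := by field_simp
      _ ≤ _ := hmax
  -- contradiction with the vanishing of the gradient of `u`
  have hu0 := h.u_deriv 0 (mem_ball_self h.R_pos)
  rw [h.V_zero, map_zero, hasFDerivAt_iff_isLittleO] at hu0
  have hsmall := hu0.def (c := 1 / (2 * C)) (by positivity)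
  have hcont : Tendsto (fun s : ℝ => g (o + s)) (𝓝[>] 0) (𝓝 0) := by
    have h1 : Tendsto (fun s : ℝ => o + (s : ℂ)) (𝓝[>] 0) (𝓝 o) := by
      have : Continuous fun s : ℝ => o + (s : ℂ) := by fun_prop
      simpa using (this.tendsto 0).mono_left nhdsWithin_le_nhds
    have h2 := (hg o hoε).2.2.tendsto
    rw [hg0] at h2
    exact h2.comp h1
  obtain ⟨s, hs1, hs2, hs3⟩ := ((hcont.eventually hsmall).and
    (Ioo_mem_nhdsGT (show (0 : ℝ) < ε / 4 by positivity))).exists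
  have hks : ‖(s : ℂ)‖ = s := by rw [Complex.norm_real, Real.norm_of_nonneg hs2.le]
  have hgs := (hg (o + s) (by rw [mem_ball_iff_norm, add_sub_cancel_left, hks]; linarith)).2.1
  have hus : u (g (o + s)) = u 0 + s := by
    simpa [ho, pairMap] using congrArg Complex.re hgs
  have hb := hcenter s (by rw [hks]; exact hs3)
  rw [hks] at hb
  simp only [hus, zero_apply, sub_zero, add_sub_cancel_left] at hs1
  rw [Real.norm_of_nonneg hs2.le] at hs1
  have : 1 / (2 * C) * ‖g (o + s)‖ ≤ 1 / (2 * C) * (C * s) :=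
    mul_le_mul_of_nonneg_left hb (by positivity)
  have h3 : 1 / (2 * C) * (C * s) = s / 2 := by field_simp
  linarith

end ConjugatePair

open scoped Convolution

theorem ContDiffBump.norm_convolution_normed_le (φ : ContDiffBump (0 : ℂ)) {X : ℂ → ℂ} {M : ℝ}
    (hM : ∀ z, ‖X z‖ ≤ M) (z : ℂ) :
    ‖(φ.normed volume ⋆[ContinuousLinearMap.lsmul ℝ ℝ, volume] X) z‖ ≤ M := by
  calc ‖(φ.normed volume ⋆[ContinuousLinearMap.lsmul ℝ ℝ, volume] X) z‖
      ≤ ∫ t, φ.normed volume t * M := by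
        refine norm_integral_le_of_norm_le (φ.integrable_normed.mul_const M)
          (Eventually.of_forall fun t => ?_)
        simp only [ContinuousLinearMap.lsmul_apply, norm_smul,
          Real.norm_of_nonneg (φ.nonneg_normed t)]
        exact mul_le_mul_of_nonneg_left (hM _) (φ.nonneg_normed t)
    _ = M := by rw [integral_mul_const, φ.integral_normed, one_mul]

section StreamFunction

variable {X : ℂ → ℂ} {R M : ℝ} (hXm : AEStronglyMeasurable X volume) (hM : ∀ z, ‖X z‖ ≤ M)
  (hXc : ContinuousOn X (ball 0 R \ {0}))
  (hdiv : ∀ φ : ℂ → ℝ, ContDiff ℝ 1 φ → HasCompactSupport φ → tsupport φ ⊆ ball 0 R →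
    ∫ z, fderiv ℝ φ z (X z) = 0)
include hXm hM hdiv

/-- Mollifications of a weakly divergence free field are divergence free. -/
theorem exists_fderiv_mollification (φ : ContDiffBump (0 : ℂ)) :
    ∃ D : ℂ → ℂ →L[ℝ] ℂ, (∀ z, HasFDerivAt
      (φ.normed volume ⋆[ContinuousLinearMap.lsmul ℝ ℝ, volume] X) (D z) z) ∧
      ∀ z, ‖z‖ + φ.rOut < R → (D z 1).re + (D z Complex.I).im = 0 := by
  have hXl : LocallyIntegrable X volume :=
    (memLp_top_of_bound hXm M (Eventually.of_forall hM)).locallyIntegrable le_top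
  have hη : ContDiff ℝ 1 (φ.normed (volume : Measure ℂ)) := φ.contDiff_normed (n := 1)
  have hηs : HasCompactSupport (φ.normed (volume : Measure ℂ)) := φ.hasCompactSupport_normed
  refine ⟨_, hηs.hasFDerivAt_convolution_left (ContinuousLinearMap.lsmul ℝ ℝ) hη hXl,
    fun z hz => ?_⟩
  set L := (ContinuousLinearMap.lsmul ℝ ℝ : ℝ →L[ℝ] ℂ →L[ℝ] ℂ)
  have hex : ConvolutionExistsAt (fderiv ℝ (φ.normed volume)) X z (L.precompL ℂ) volume :=
    (hηs.fderiv ℝ).convolutionExists_left _ (hη.continuous_fderiv one_ne_zero) hXl z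
  let ℓ : (ℂ →L[ℝ] ℂ) →L[ℝ] ℝ :=
    Complex.reCLM ∘L (ContinuousLinearMap.apply ℝ ℂ (1 : ℂ)) +
      Complex.imCLM ∘L (ContinuousLinearMap.apply ℝ ℂ Complex.I)
  have hℓ : ∀ A : ℂ →L[ℝ] ℂ, ℓ A = (A 1).re + (A Complex.I).im := fun A => by
    simp [ℓ]
  rw [← hℓ]
  have h1 := ℓ.integral_comp_comm hex.integrable
  have h2 : (fderiv ℝ (φ.normed volume) ⋆[L.precompL ℂ, volume] X) z =
      ∫ t, L.precompL ℂ (fderiv ℝ (φ.normed volume) t) (X (z - t)) := rfl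
  rw [h2, ← h1]
  have h3 : ∀ t, ℓ (L.precompL ℂ (fderiv ℝ (φ.normed volume) t) (X (z - t))) =
      fderiv ℝ (φ.normed volume) t (X (z - t)) := by
    intro t
    rw [hℓ]
    have hX : X (z - t) = (X (z - t)).re • (1 : ℂ) + (X (z - t)).im • Complex.I := by
      simp
    conv_rhs => rw [hX, map_add, map_smul, map_smul]
    simp [L, ContinuousLinearMap.precompL_apply, mul_comm]
  simp_rw [h3]
  have hsub : ContDiff ℝ 1 fun w => φ.normed volume (z - w) :=
    hη.comp (contDiff_const.sub contDiff_id)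
  have hts : tsupport (fun w => φ.normed volume (z - w)) ⊆ closedBall z φ.rOut := by
    refine closure_minimal (fun w hw => ?_) isClosed_closedBall
    have : z - w ∈ Function.support (φ.normed volume) := hw
    rw [φ.support_normed_eq, mem_ball_zero_iff] at this
    rw [mem_closedBall_iff_norm, norm_sub_rev]
    exact this.le
  have h4 := hdiv (fun w => φ.normed volume (z - w)) hsub
    ((isCompact_closedBall z φ.rOut).of_isClosed_subset (isClosed_tsupport _) hts)
    (hts.trans (closedBall_subset_ball' (by rw [dist_zero_right]; linarith)))
  have h5 : ∀ w, fderiv ℝ (fun w => φ.normed volume (z - w)) w (X w) =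
      -(fderiv ℝ (φ.normed volume) (z - w) (X w)) := by
    intro w
    have : HasFDerivAt (fun w => φ.normed volume (z - w)) _ w :=
      ((hη.differentiable one_ne_zero (z - w)).hasFDerivAt).comp w
        ((hasFDerivAt_id w).const_sub z)
    rw [this.fderiv]
    simp
  simp_rw [h5, integral_neg, neg_eq_zero] at h4
  rw [← h4, ← integral_sub_left_eq_self _ volume z]
  simp

include hXc

/-- A bounded weakly divergence free field on a disc, continuous off the center, has, rotated by a
right angle, path independent integrals along segments. -/
theorem curveIntegral_segment_add_eq_of_weakly_divergence_free {ρ : ℝ} (hρ : ρ < R) {a b c : ℂ}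
    (ha : a ∈ ball (0 : ℂ) ρ) (hb : b ∈ ball (0 : ℂ) ρ) (hc : c ∈ ball (0 : ℂ) ρ) :
    (∫ᶜ x in .segment a b, innerSL ℝ (Complex.I * X x)) +
      ∫ᶜ x in .segment b c, innerSL ℝ (Complex.I * X x) =
      ∫ᶜ x in .segment a c, innerSL ℝ (Complex.I * X x) := by
  have hδ : 0 < R - ρ := by linarith
  let φ : ℕ → ContDiffBump (0 : ℂ) := fun n =>
    ⟨(R - ρ) / (n + 3), (R - ρ) / (n + 2), by positivity, by gcongr; linarith⟩
  have hφ : Tendsto (fun n => (φ n).rOut) atTop (𝓝 0) := by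
    have h1 : Tendsto (fun n : ℕ => (n : ℝ) + 2) atTop atTop :=
      tendsto_atTop_add_const_right _ _ tendsto_natCast_atTop_atTop
    exact h1.const_div_atTop (R - ρ)
  have hφ2 : ∀ n, (φ n).rOut < R - ρ := fun n => by
    change (R - ρ) / ((n : ℝ) + 2) < R - ρ
    rw [div_lt_iff₀ (by positivity)]
    have : (0 : ℝ) ≤ n := n.cast_nonneg
    nlinarith
  set Y : ℕ → ℂ → ℂ := fun n => (φ n).normed volume ⋆[ContinuousLinearMap.lsmul ℝ ℝ, volume] X
    with hY
  have hadd : ∀ n, (∫ᶜ x in .segment a b, innerSL ℝ (Complex.I * Y n x)) +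
      ∫ᶜ x in .segment b c, innerSL ℝ (Complex.I * Y n x) =
      ∫ᶜ x in .segment a c, innerSL ℝ (Complex.I * Y n x) := by
    intro n
    obtain ⟨D, hD, hD0⟩ := exists_fderiv_mollification hXm hM hdiv (φ n)
    refine (convex_ball (0 : ℂ) ρ).curveIntegral_segment_add_eq_of_hasFDerivWithinAt_symmetric
      (dω := fun z => (innerSL ℝ : ℂ →L[ℝ] ℂ →L[ℝ] ℝ) ∘L
        ((ContinuousLinearMap.mul ℝ ℂ Complex.I) ∘L D z)) (fun z _ => ?_) ?_ ha hb hc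
    · exact ((innerSL ℝ : ℂ →L[ℝ] ℂ →L[ℝ] ℝ).hasFDerivAt.comp z
        ((ContinuousLinearMap.mul ℝ ℂ Complex.I).hasFDerivAt.comp z (hD z))).hasFDerivWithinAt
    · intro z hz x _ y _
      have h0 := hD0 z (by
        have := mem_ball_zero_iff.1 hz
        linarith [hφ2 n])
      have hx : ∀ x : ℂ, D z x = x.re • D z 1 + x.im • D z Complex.I := fun x => by
        conv_lhs => rw [show x = x.re • (1 : ℂ) + x.im • Complex.I by simp]
        rw [map_add, map_smul, map_smul]
      change ⟪Complex.I * D z x, y⟫ = ⟪Complex.I * D z y, x⟫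
      rw [hx x, hx y]
      simp only [Complex.inner, Complex.real_smul, Complex.mul_re, Complex.mul_im,
        Complex.add_re, Complex.add_im, Complex.ofReal_re, Complex.ofReal_im, Complex.I_re,
        Complex.I_im, Complex.conj_re, Complex.conj_im]
      linear_combination (x.re * y.im - x.im * y.re) * h0
  have hlim : ∀ a ∈ ball (0 : ℂ) ρ, ∀ b ∈ ball (0 : ℂ) ρ,
      Tendsto (fun n => ∫ᶜ x in .segment a b, innerSL ℝ (Complex.I * Y n x)) atTop
        (𝓝 (∫ᶜ x in .segment a b, innerSL ℝ (Complex.I * X x))) := by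
    intro a ha b hb
    simp only [curveIntegral_segment]
    rcases eq_or_ne a b with rfl | hab
    · simp
    have hYc : ∀ n, Continuous (Y n) := fun n => by
      obtain ⟨D, hD, -⟩ := exists_fderiv_mollification hXm hM hdiv (φ n)
      exact continuous_iff_continuousAt.2 fun z => (hD z).continuousAt
    refine intervalIntegral.tendsto_integral_filter_of_dominated_convergence
      (fun _ => M * ‖b - a‖) (Eventually.of_forall fun n => ?_) (Eventually.of_forall fun n => ?_)
      (by simp) ?_
    · refine Continuous.aestronglyMeasurable ?_
      have h1 : Continuous fun t : ℝ => Complex.I * Y n (AffineMap.lineMap a b t) :=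
        continuous_const.mul ((hYc n).comp AffineMap.lineMap_continuous)
      exact h1.inner continuous_const
    · refine Eventually.of_forall fun t _ => ?_
      rw [innerSL_apply_apply]
      refine (norm_inner_le_norm _ _).trans ?_
      rw [norm_mul, Complex.norm_I, one_mul]
      gcongr
      exact (φ n).norm_convolution_normed_le hM _
    · have hinj : {t : ℝ | AffineMap.lineMap a b t = (0 : ℂ)}.Subsingleton := by
        intro t ht s hs
        exact AffineMap.lineMap_injective ℝ hab (ht.trans hs.symm)
      have hnull := hinj.countable.ae_notMem volume
      filter_upwards [hnull] with t ht htI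
      rw [uIoc_of_le zero_le_one] at htI
      have hz : AffineMap.lineMap a b t ∈ ball (0 : ℂ) R \ {0} :=
        ⟨ball_subset_ball hρ.le ((convex_ball (0 : ℂ) ρ).lineMap_mem ha hb ⟨htI.1.le, htI.2⟩), ht⟩
      have hXz : ContinuousAt X (AffineMap.lineMap a b t) :=
        hXc.continuousAt ((isOpen_ball.sdiff isClosed_singleton).mem_nhds hz)
      have h1 : Tendsto (fun n => Y n (AffineMap.lineMap a b t)) atTop
          (𝓝 (X (AffineMap.lineMap a b t))) :=
        ContDiffBump.convolution_tendsto_right (g := fun _ => X) hφ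
          (Eventually.of_forall fun _ => hXm) (hXz.tendsto.comp tendsto_snd) tendsto_const_nhds
      have h2 : Continuous fun y : ℂ => innerSL ℝ (Complex.I * y) (b - a) :=
        (continuous_const.mul continuous_id).inner continuous_const
      exact (h2.tendsto _).comp h1
  have h1 := (hlim a ha b hb).add (hlim b hb c hc)
  simp_rw [hadd] at h1
  exact tendsto_nhds_unique h1 (hlim a ha c hc)

/-- Existence of a stream function. -/
theorem exists_stream_function (hR : 0 < R) : ∃ v : ℂ → ℝ,
    (∀ z ∈ ball (0 : ℂ) (R / 2), z ≠ 0 → HasFDerivAt v (innerSL ℝ (Complex.I * X z)) z) ∧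
    ∀ r ≤ R / 2, ∀ K, (∀ z ∈ ball (0 : ℂ) r, ‖X z‖ ≤ K) →
      ∀ a ∈ ball (0 : ℂ) r, ∀ b ∈ ball (0 : ℂ) r, |v a - v b| ≤ K * ‖a - b‖ := by
  have h0 : (0 : ℂ) ∈ ball (0 : ℂ) (R / 2) := mem_ball_self (by positivity)
  set v : ℂ → ℝ := fun z => ∫ᶜ x in .segment 0 z, innerSL ℝ (Complex.I * X x) with hv
  have hvab : ∀ a ∈ ball (0 : ℂ) (R / 2), ∀ b ∈ ball (0 : ℂ) (R / 2),
      v b = v a + ∫ᶜ x in .segment a b, innerSL ℝ (Complex.I * X x) := fun a ha b hb =>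
    (curveIntegral_segment_add_eq_of_weakly_divergence_free hXm hM hXc hdiv (half_lt_self hR)
      h0 ha hb).symm
  refine ⟨v, fun z hz hz0 => ?_, fun r hr K hK a ha b hb => ?_⟩
  · have hU : IsOpen (ball (0 : ℂ) R \ {0}) := isOpen_ball.sdiff isClosed_singleton
    have h1 : HasFDerivAt (fun b => ∫ᶜ x in .segment z b, innerSL ℝ (Complex.I * X x))
        (innerSL ℝ (Complex.I * X z)) z := by
      refine HasFDerivAt.curveIntegral_segment_source'
        (ω := fun x => innerSL ℝ (Complex.I * X x)) ?_
      filter_upwards [hU.mem_nhds ⟨ball_subset_ball (half_le_self hR.le) hz, hz0⟩] with y hy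
      exact (innerSL ℝ : ℂ →L[ℝ] ℂ →L[ℝ] ℝ).continuous.continuousAt.comp
        (continuousAt_const.mul (hXc.continuousAt (hU.mem_nhds hy)))
    refine (h1.const_add (v z)).congr_of_eventuallyEq ?_
    filter_upwards [isOpen_ball.mem_nhds hz] with b hb using hvab z hz b hb
  · have hsub := ball_subset_ball (x := (0 : ℂ)) hr
    rw [hvab b (hsub hb) a (hsub ha), add_sub_cancel_left, ← Real.norm_eq_abs]
    refine norm_curveIntegral_segment_le fun z hz => ?_
    rw [innerSL_apply_norm, norm_mul, Complex.norm_I, one_mul]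
    exact hK z ((convex_ball (0 : ℂ) r).segment_subset hb ha hz)

end StreamFunction

theorem hasDerivAt_norm_add_smul {E : Type*} [NormedAddCommGroup E] [InnerProductSpace ℝ E]
    {a : E} (ha : a ≠ 0) (b : E) : HasDerivAt (fun t : ℝ => ‖a + t • b‖) (⟪a, b⟫ / ‖a‖) 0 := by
  have h1 : HasDerivAt (fun t : ℝ => a + t • b) b 0 := by
    simpa using ((hasDerivAt_id (0 : ℝ)).smul_const b).const_add a
  have h2 := h1.norm_sq.sqrt (by simpa using ha)
  simp only [Real.sqrt_sq (norm_nonneg _), zero_smul, add_zero] at h2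
  rwa [mul_div_mul_left _ _ two_ne_zero] at h2

theorem exists_lipschitzOnWith_Icc {f : ℝ → ℝ} (hf : ContDiffOn ℝ 1 f (Ici 0)) (M : ℝ) :
    ∃ C : NNReal, LipschitzOnWith C f (Icc 0 M) := by
  have hc : ContinuousOn (derivWithin f (Ici 0)) (Icc 0 M) :=
    (hf.continuousOn_derivWithin (uniqueDiffOn_Ici 0) le_rfl).mono Icc_subset_Ici_self
  obtain ⟨C, hC⟩ := isCompact_Icc.exists_bound_of_continuousOn hc
  refine ⟨C.toNNReal, (convex_Icc 0 M).lipschitzOnWith_of_nnnorm_hasDerivWithin_le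
    (f' := derivWithin f (Ici 0)) (fun x hx => ?_) fun x hx => ?_⟩
  · exact ((hf.differentiableOn one_ne_zero x hx.1).hasDerivWithinAt).mono Icc_subset_Ici_self
  · rw [← NNReal.coe_le_coe, coe_nnnorm]
    exact (hC x hx).trans (Real.le_coe_toNNReal C)

theorem hasDerivAt_comp_norm_add_smul {f : ℝ → ℝ} (hf : ContDiffOn ℝ 1 f (Ici 0))
    {E : Type*} [NormedAddCommGroup E] [InnerProductSpace ℝ E] {a : E} (ha : a ≠ 0) (b : E) :
    HasDerivAt (fun t : ℝ => f ‖a + t • b‖) (dtop f ‖a‖ / ‖a‖ * ⟪a, b⟫) 0 := by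
  have hmem : Ici (0 : ℝ) ∈ 𝓝 ‖a‖ := Ici_mem_nhds (norm_pos_iff.2 ha)
  have h1 : HasDerivAt f (dtop f ‖a‖) ‖a + (0 : ℝ) • b‖ := by
    rw [zero_smul, add_zero]
    exact ((hf.differentiableOn one_ne_zero _ (norm_nonneg a)).hasDerivWithinAt).hasDerivAt hmem
  rw [div_mul_eq_mul_div, mul_div_assoc]
  exact h1.comp (0 : ℝ) (hasDerivAt_norm_add_smul ha b)

theorem gradient_add_const_mul {u φ : E2 → ℝ} {x : E2} (hu : DifferentiableAt ℝ u x)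
    (hφ : DifferentiableAt ℝ φ x) (t : ℝ) :
    gradient (fun y => u y + t * φ y) x = gradient u x + t • gradient φ x := by
  have h : HasFDerivAt (fun y => u y + t * φ y) (fderiv ℝ u x + t • fderiv ℝ φ x) x :=
    hu.hasFDerivAt.add (hφ.hasFDerivAt.const_mul t)
  simp only [gradient, h.fderiv, map_add, map_smul]

theorem inner_gradient_eq_fderiv (u : E2 → ℝ) (x y : E2) : ⟪gradient u x, y⟫ = fderiv ℝ u x y := by
  rw [gradient, InnerProductSpace.toDual_symm_apply]

theorem continuousOn_gradient {u : E2 → ℝ} {Ω : Set E2} (hΩ : IsOpen Ω)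
    (hu : ContDiffOn ℝ 1 u Ω) : ContinuousOn (gradient u) Ω :=
  (InnerProductSpace.toDual ℝ E2).symm.continuous.comp_continuousOn
    (hu.continuousOn_fderiv_of_isOpen hΩ le_rfl)

theorem norm_gradient (u : E2 → ℝ) (x : E2) : ‖gradient u x‖ = ‖fderiv ℝ u x‖ := by
  rw [gradient, LinearIsometryEquiv.norm_map]

/-- The Euler-Lagrange equation, tested with functions supported where the gradient does not
vanish, up to a null set. -/
theorem SolvesP.integral_eq_zero {f : ℝ → ℝ} {Ω : Set E2} {ψ u : E2 → ℝ} (hu : SolvesP f Ω ψ u)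
    (hf : ContDiffOn ℝ 1 f (Ici 0)) (hΩo : IsOpen Ω) (hΩb : Bornology.IsBounded Ω)
    (huC1 : ContDiffOn ℝ 1 u Ω) {φ : E2 → ℝ} (hφ : ContDiff ℝ 1 φ) (hφc : HasCompactSupport φ)
    (hφΩ : tsupport φ ⊆ Ω) (h0 : ∀ᵐ x, x ∈ tsupport φ → gradient u x ≠ 0) :
    ∫ x, dtop f ‖gradient u x‖ / ‖gradient u x‖ * fderiv ℝ φ x (gradient u x) = 0 := by
  obtain ⟨⟨L, hL⟩, hψ, hmin⟩ := hu
  obtain ⟨B, hB⟩ := hφ.lipschitzWith_of_hasCompactSupport hφc one_ne_zero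
  have hud : ∀ x ∈ Ω, DifferentiableAt ℝ u x := fun x hx =>
    (huC1.differentiableOn one_ne_zero).differentiableAt (hΩo.mem_nhds hx)
  have hφd := hφ.differentiable one_ne_zero
  have hG := continuousOn_gradient hΩo huC1
  have hGφ : Continuous (gradient φ) :=
    continuousOn_univ.1 (continuousOn_gradient isOpen_univ hφ.contDiffOn)
  have hGL : ∀ x ∈ Ω, ‖gradient u x‖ ≤ L := fun x hx => by
    rw [norm_gradient]
    exact norm_fderiv_le_of_lipschitzOn ℝ (hΩo.mem_nhds hx) (hL.mono subset_closure)
  have hGB : ∀ x, ‖gradient φ x‖ ≤ B := fun x => by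
    rw [norm_gradient]
    exact norm_fderiv_le_of_lipschitz ℝ hB
  have hfc : ContinuousOn f (Ici 0) := hf.continuousOn
  have hsub : ∀ x ∉ tsupport φ, fderiv ℝ φ x = 0 := fun x hx => by
    rw [← Function.notMem_support]
    exact fun h => hx (tsupport_fderiv_subset ℝ (subset_tsupport _ h))
  have : IsFiniteMeasure (volume.restrict Ω) := ⟨by
    rw [Measure.restrict_apply_univ]
    exact hΩb.measure_lt_top⟩
  obtain ⟨C, hC⟩ := exists_lipschitzOnWith_Icc hf (L + B)
  have hcont : ∀ t : ℝ, ContinuousOn (fun x => f ‖gradient u x + t • gradient φ x‖) Ω := fun t =>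
    hfc.comp (hG.add (hGφ.continuousOn.const_smul t)).norm fun x _ => norm_nonneg _
  have hJ : ∀ t : ℝ, J f Ω (fun y => u y + t * φ y) =
      ∫ x in Ω, f ‖gradient u x + t • gradient φ x‖ := fun t =>
    setIntegral_congr_fun hΩo.measurableSet fun x hx => by
      simp only [gradient_add_const_mul (hud x hx) (hφd x)]
  have hint : Integrable (fun x => f ‖gradient u x + (0 : ℝ) • gradient φ x‖)
      (volume.restrict Ω) := by
    obtain ⟨K, hK⟩ := (isCompact_Icc (a := (0 : ℝ)) (b := L)).exists_bound_of_continuousOn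
      (hfc.mono Icc_subset_Ici_self)
    refine .of_bound ((hcont 0).aestronglyMeasurable hΩo.measurableSet) K ?_
    filter_upwards [ae_restrict_mem hΩo.measurableSet] with x hx
    rw [zero_smul, add_zero]
    exact hK _ ⟨norm_nonneg _, hGL x hx⟩
  have hder : ∀ᵐ x ∂volume.restrict Ω,
      HasDerivAt (fun t : ℝ => f ‖gradient u x + t • gradient φ x‖)
        (dtop f ‖gradient u x‖ / ‖gradient u x‖ * fderiv ℝ φ x (gradient u x)) 0 := by
    filter_upwards [ae_restrict_of_ae h0] with x hx
    rcases eq_or_ne (fderiv ℝ φ x) 0 with h | h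
    · have : gradient φ x = 0 := by rw [gradient, h, map_zero]
      simpa [h, this] using hasDerivAt_const (0 : ℝ) (f ‖gradient u x‖)
    · rw [← inner_gradient_eq_fderiv, real_inner_comm]
      exact hasDerivAt_comp_norm_add_smul hf (hx (not_imp_comm.1 (hsub x) h)) _
  have hmeas : AEMeasurable
      (fun x => dtop f ‖gradient u x‖ / ‖gradient u x‖ * fderiv ℝ φ x (gradient u x))
      (volume.restrict Ω) := by
    have h1 : ContinuousOn (fun x => dtop f ‖gradient u x‖) Ω :=
      (hf.continuousOn_derivWithin (uniqueDiffOn_Ici 0) le_rfl).comp hG.norm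
        fun x _ => norm_nonneg _
    have h2 : ContinuousOn (fun x => fderiv ℝ φ x (gradient u x)) Ω :=
      (hφ.continuous_fderiv one_ne_zero).continuousOn.clm_apply hG
    exact ((h1.aemeasurable hΩo.measurableSet).div (hG.norm.aemeasurable hΩo.measurableSet)).mul
      (h2.aemeasurable hΩo.measurableSet)
  have key := hasDerivAt_integral_of_dominated_loc_of_lip (𝕜 := ℝ) (μ := volume.restrict Ω)
    (bound := fun _ => (C * B : ℝ)) (x₀ := 0) (s := Icc (-1) 1)
    (F := fun t x => f ‖gradient u x + t • gradient φ x‖)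
    (Icc_mem_nhds (by norm_num) (by norm_num))
    (.of_forall fun t => (hcont t).aestronglyMeasurable hΩo.measurableSet) hint
    hmeas.aestronglyMeasurable ?_ (integrable_const _) hder
  · have hloc : IsLocalMin (fun t : ℝ => ∫ x in Ω, f ‖gradient u x + t • gradient φ x‖) 0 := by
      refine .of_forall fun t => ?_
      beta_reduce
      rw [← hJ, ← hJ]
      simp only [zero_mul, add_zero]
      have hB' : LipschitzWith (‖t‖₊ * B) fun y => t * φ y :=
        (lipschitzWith_smul t).comp hB
      refine hmin _ ⟨_, hL.add hB'.lipschitzOnWith⟩ fun x hx => ?_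
      have : φ x = 0 := image_eq_zero_of_notMem_tsupport fun h =>
        (hΩo.frontier_eq ▸ hx).2 (hφΩ h)
      simp [this, hψ hx]
    rw [← hloc.hasDerivAt_eq_zero key.2]
    refine (setIntegral_eq_integral_of_forall_compl_eq_zero fun x hx => ?_).symm
    rw [hsub x fun h => hx (hφΩ h), zero_apply, mul_zero]
  · filter_upwards [ae_restrict_mem hΩo.measurableSet] with x hx
    refine .of_dist_le_mul fun s hs t ht => ?_
    have hmem : ∀ t ∈ Icc (-1 : ℝ) 1, ‖gradient u x + t • gradient φ x‖ ∈ Icc (0 : ℝ) (L + B) :=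
      fun t ht => by
        refine ⟨norm_nonneg _, (norm_add_le _ _).trans (add_le_add (hGL x hx) ?_)⟩
        rw [norm_smul, Real.norm_eq_abs]
        exact (mul_le_of_le_one_left (norm_nonneg _) (abs_le.2 ht)).trans (hGB x)
    refine (hC.dist_le_mul _ (hmem s hs) _ (hmem t ht)).trans ?_
    rw [Real.coe_nnabs, abs_of_nonneg (by positivity), mul_assoc]
    gcongr
    refine (dist_norm_norm_le _ _).trans ?_
    rw [dist_eq_norm, add_sub_add_left_eq_sub, ← sub_smul, norm_smul, mul_comm, ← dist_eq_norm]
    gcongr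
    exact hGB x

/-- A disc does not carry a function with gradient `V` vanishing only at the center such that the
field `β ‖V‖ • V / ‖V‖` is weakly divergence free. -/
theorem false_of_weakly_divergence_free {R : ℝ} (hR : 0 < R) {β : ℝ → ℝ}
    (hβ : StrictMonoOn β (Ici 0)) (hβc : ContinuousOn β (Ici 0)) (hβ0 : 0 < β 0)
    {u : ℂ → ℝ} {V : ℂ → ℂ} (hu : ∀ z ∈ ball 0 R, HasFDerivAt u (innerSL ℝ (V z)) z)
    (hV : ContinuousOn V (ball 0 R)) (hV0 : V 0 = 0) (hV1 : ∀ z ∈ ball 0 R, ‖V z‖ ≤ 1)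
    (hVne : ∀ z ∈ ball 0 R, z ≠ 0 → V z ≠ 0)
    (hdiv : ∀ φ : ℂ → ℝ, ContDiff ℝ 1 φ → HasCompactSupport φ → tsupport φ ⊆ ball 0 R →
      ∫ z, β ‖V z‖ / ‖V z‖ * fderiv ℝ φ z (V z) = 0) : False := by
  set α : ℝ → ℝ := fun q => β q / β 0 with hα
  have hαmono : StrictMonoOn α (Ici 0) := fun x hx y hy h =>
    div_lt_div_of_pos_right (hβ hx hy h) hβ0
  have hαc : ContinuousOn α (Ici 0) := hβc.div_const _
  have hα0 : α 0 = 1 := div_self hβ0.ne'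
  have hα1 : ∀ q, 0 ≤ q → 1 ≤ α q := fun q hq => hα0 ▸ hαmono.monotoneOn self_mem_Ici hq hq
  set X : ℂ → ℂ := (ball 0 R \ {0}).indicator fun z => (α ‖V z‖ / ‖V z‖) • V z with hX
  have hXmem : ∀ z ∈ ball 0 R, z ≠ 0 → X z = (α ‖V z‖ / ‖V z‖) • V z := fun z hz h =>
    indicator_of_mem (show z ∈ ball 0 R \ {0} from ⟨hz, h⟩) _
  have hXn : ∀ z ∈ ball 0 R, ‖X z‖ ≤ α ‖V z‖ := fun z hz => by
    rcases eq_or_ne z 0 with rfl | h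
    · simpa [X] using zero_le_one.trans (hα1 _ (norm_nonneg _))
    · rw [hXmem z hz h, norm_smul, norm_div, norm_norm,
        div_mul_cancel₀ _ (norm_ne_zero_iff.2 (hVne z hz h)), Real.norm_of_nonneg]
      exact zero_le_one.trans (hα1 _ (norm_nonneg _))
  have hgc : ContinuousOn (fun z => (α ‖V z‖ / ‖V z‖) • V z) (ball 0 R \ {0}) := by
    have hV' := hV.mono (sdiff_subset (t := {0}))
    exact ((hαc.comp hV'.norm fun z _ => norm_nonneg _).div hV'.norm
      fun z hz => norm_ne_zero_iff.2 (hVne z hz.1 hz.2)).smul hV'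
  have hU : MeasurableSet (ball (0 : ℂ) R \ {0}) :=
    measurableSet_ball.diff (measurableSet_singleton 0)
  have hXc : ContinuousOn X (ball 0 R \ {0}) := hgc.congr fun z hz => indicator_of_mem hz _
  have hXm : AEStronglyMeasurable X volume :=
    (aestronglyMeasurable_indicator_iff hU).2 (hgc.aestronglyMeasurable hU)
  have hXM : ∀ z, ‖X z‖ ≤ α 1 := fun z => by
    by_cases hz : z ∈ ball 0 R
    · exact (hXn z hz).trans (hαmono.monotoneOn (norm_nonneg _) (zero_le_one' ℝ) (hV1 z hz))
    · rw [hX, indicator_of_notMem fun h => hz h.1, norm_zero]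
      exact zero_le_one.trans (hα1 1 zero_le_one)
  have hXdiv : ∀ φ : ℂ → ℝ, ContDiff ℝ 1 φ → HasCompactSupport φ → tsupport φ ⊆ ball 0 R →
      ∫ z, fderiv ℝ φ z (X z) = 0 := by
    intro φ h1 h2 h3
    have : ∀ z, fderiv ℝ φ z (X z) = (β 0)⁻¹ * (β ‖V z‖ / ‖V z‖ * fderiv ℝ φ z (V z)) := by
      intro z
      by_cases hz : z ∈ ball 0 R
      · rcases eq_or_ne z 0 with rfl | h
        · simp [X, hV0]
        · rw [hXmem z hz h, map_smul, smul_eq_mul, hα]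
          ring
      · have : fderiv ℝ φ z = 0 := by
          rw [← Function.notMem_support]
          exact fun h => hz (h3 (tsupport_fderiv_subset ℝ (subset_tsupport _ h)))
        simp [this]
    simp_rw [this, integral_const_mul, hdiv φ h1 h2 h3, mul_zero]
  obtain ⟨v, hv, hvl⟩ := exists_stream_function hXm hXM hXc hXdiv hR
  have hsub : ball (0 : ℂ) (R / 2) ⊆ ball 0 R := ball_subset_ball (half_le_self hR.le)
  refine ConjugatePair.false (R := R / 2) (α := α) (u := u) (v := v) (V := V)
    ⟨half_pos hR, fun z hz => hu z (hsub hz), hV.mono hsub, hV0, fun z hz => hVne z (hsub hz),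
      hαmono, hαc, hα0, fun z hz h0 => ?_, fun ε hε => ?_⟩
  · have := hv z hz h0
    rwa [hXmem z (hsub hz) h0, mul_smul_comm] at this
  · have h1 : ∀ᶠ q in 𝓝[≥] (0 : ℝ), α q < 1 + ε :=
      (hαc 0 self_mem_Ici).eventually_lt_const (by rw [hα0]; linarith)
    have h2 : Tendsto (fun z => ‖V z‖) (𝓝 0) (𝓝[≥] 0) := by
      refine tendsto_nhdsWithin_iff.2 ⟨?_, .of_forall fun z => norm_nonneg _⟩
      simpa [hV0] using (hV.continuousAt (ball_mem_nhds 0 hR)).norm.tendsto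
    obtain ⟨δ, hδ, h3⟩ := Metric.eventually_nhds_iff_ball.1 (h2.eventually h1)
    refine ⟨min δ (R / 2), lt_min hδ (half_pos hR), min_le_right _ _, hvl _ (min_le_right _ _) _
      fun z hz => ?_⟩
    exact (hXn z (hsub (ball_subset_ball (min_le_right _ _) hz))).trans
      (h3 z (ball_subset_ball (min_le_left _ _) hz)).le

/-- A `C¹` solution of the variational problem (P) cannot have isolated
critical points. -/
theorem minimizer_hasNoIsolatedCriticalPoint
    (f : ℝ → ℝ) (hf : StdF f)
    (Ω : Set E2) (hΩo : IsOpen Ω) (hΩb : Bornology.IsBounded Ω)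
    (ψ : E2 → ℝ) (hψ : ContinuousOn ψ (frontier Ω))
    (u : E2 → ℝ) (hu : SolvesP f Ω ψ u) (huC1 : ContDiffOn ℝ 1 u Ω) :
    ¬ HasIsolatedCritPt Ω u := by
  rintro ⟨z₀, hz₀, r, hr, hcrit, hne⟩
  obtain ⟨hconv, hfC1, -, -, hf0⟩ := hf
  have hG := continuousOn_gradient hΩo huC1
  have hG1 : ∀ᶠ z in 𝓝 z₀, ‖gradient u z‖ < 1 :=
    (hG.continuousAt (hΩo.mem_nhds hz₀)).norm.eventually_lt_const (by simp [hcrit])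
  obtain ⟨R, hR, hball⟩ := Metric.eventually_nhds_iff_ball.1
    ((hΩo.eventually_mem hz₀).and (hG1.and (isOpen_ball.eventually_mem (mem_ball_self hr))))
  let e : ℂ ≃ₗᵢ[ℝ] E2 := Complex.orthonormalBasisOneI.repr
  set T : ℂ → E2 := fun z => e z + z₀ with hT
  have hTball : ∀ z ∈ ball (0 : ℂ) R, T z ∈ ball z₀ R := fun z hz => by
    simpa [hT, mem_ball_iff_norm] using hz
  have hTΩ : ∀ z ∈ ball (0 : ℂ) R, T z ∈ Ω := fun z hz => (hball _ (hTball z hz)).1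
  have hTd : ∀ z, HasFDerivAt T (e : ℂ →L[ℝ] E2) z := fun z =>
    (e : ℂ →L[ℝ] E2).hasFDerivAt.add_const z₀
  have hTc : Continuous T := e.continuous.add_const z₀
  set V : ℂ → ℂ := fun z => e.symm (gradient u (T z))
  have hVn : ∀ z, ‖V z‖ = ‖gradient u (T z)‖ := fun z => e.symm.norm_map _
  refine false_of_weakly_divergence_free hR (β := dtop f) (u := u ∘ T) (V := V)
    (hconv.strictMonoOn_derivWithin (hfC1.differentiableOn one_ne_zero))
    (hfC1.continuousOn_derivWithin (uniqueDiffOn_Ici 0) le_rfl) hf0 (fun z hz => ?_)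
    (e.symm.continuous.comp_continuousOn (hG.comp hTc.continuousOn hTΩ))
    (by simp [V, T, hcrit]) (fun z hz => (hVn z).trans_le (hball _ (hTball z hz)).2.1.le)
    (fun z hz h0 => ?_) (fun φ hφ hφc hφR => ?_)
  · have h1 := ((huC1.differentiableOn one_ne_zero).differentiableAt
      (hΩo.mem_nhds (hTΩ z hz))).hasFDerivAt.comp z (hTd z)
    have h2 : innerSL ℝ (V z) = fderiv ℝ u (T z) ∘L (e : ℂ →L[ℝ] E2) := by
      refine ContinuousLinearMap.ext fun w => ?_
      change ⟪e.symm (gradient u (T z)), w⟫ = fderiv ℝ u (T z) (e w)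
      rw [← inner_gradient_eq_fderiv, ← e.inner_map_map, e.apply_symm_apply]
    rwa [h2]
  · rw [← norm_ne_zero_iff, hVn, norm_ne_zero_iff]
    exact hne _ (hTΩ z hz) (by simpa [hT] using h0) (hball _ (hTball z hz)).2.2
  · let S : E2 → ℂ := fun x => e.symm x - e.symm z₀
    have hST : ∀ z, S (T z) = z := fun z => by simp [S, hT]
    have hTS : ∀ x, T (S x) = x := fun x => by simp [S, hT]
    have hSd : ContDiff ℝ 1 S := e.symm.contDiff.sub contDiff_const
    have hSf : ∀ x, HasFDerivAt S (e.symm : E2 →L[ℝ] ℂ) x := fun x =>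
      (e.symm : E2 →L[ℝ] ℂ).hasFDerivAt.sub_const _
    have hsupp : tsupport (φ ∘ S) ⊆ T '' tsupport φ := fun x hx =>
      ⟨S x, tsupport_comp_subset_preimage φ hSd.continuous hx, hTS x⟩
    have hcomp : HasCompactSupport (φ ∘ S) :=
      (hφc.isCompact.image hTc).of_isClosed_subset (isClosed_tsupport _) hsupp
    have hball' : ∀ x ∈ tsupport (φ ∘ S), x ∈ ball z₀ R := fun x hx => by
      obtain ⟨z, hz, rfl⟩ := hsupp hx
      exact hTball z (hφR hz)
    have h0 : ∀ᵐ x, x ∈ tsupport (φ ∘ S) → gradient u x ≠ 0 := by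
      filter_upwards [compl_mem_ae_iff.2 (measure_singleton z₀)] with x hx hxs
      exact hne x (hball x (hball' x hxs)).1 hx (hball x (hball' x hxs)).2.2
    have hint : ∀ h : E2 → ℝ, ∫ z, h (T z) = ∫ x, h x := fun h =>
      (e.measurePreserving.integral_comp e.toHomeomorph.measurableEmbedding
        fun y => h (y + z₀)).trans (integral_add_right_eq_self h z₀)
    rw [← hu.integral_eq_zero hfC1 hΩo hΩb huC1 (hφ.comp hSd) hcomp
        (fun x hx => (hball x (hball' x hx)).1) h0,
      ← hint]
    refine integral_congr_ae (.of_forall fun z => ?_)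
    have h1 : fderiv ℝ (φ ∘ S) (T z) = fderiv ℝ φ z ∘L (e.symm : E2 →L[ℝ] ℂ) := by
      rw [← hST z, hTS]
      exact ((hφ.differentiable one_ne_zero _).hasFDerivAt.comp _ (hSf (T z))).fderiv
    change dtop f ‖V z‖ / ‖V z‖ * fderiv ℝ φ z (V z) =
      dtop f ‖gradient u (T z)‖ / ‖gradient u (T z)‖ *
        fderiv ℝ (φ ∘ S) (T z) (gradient u (T z))
    rw [h1, hVn]
    rfl
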